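/- For every compact set K ⊆ Ω the restriction of the Kobayashi–Royden pseudonorm to unit tangent vectors over K is bounded: sup { F_Ω(p, v) : p ∈ K, v ∈ ℂⁿ, ‖v‖ = 1 } < ∞, where ‖·‖ is the standard norm on ℂⁿ. -/

import Mathlib

open Metric Set Filter
open scoped ENNReal Topology

noncomputable section

abbrev Cn (n : ℕ) := EuclideanSpace ℂ (Fin n)

def IsAlmostComplexOn (n : ℕ) (Ω : Set (Cn n)) (J : Cn n → (Cn n →L[ℝ] Cn n)) : Prop :=
  ContDiffOn ℝ (⊤ : ℕ∞) J Ω ∧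
    ∀ x ∈ Ω, (J x).comp (J x) = -ContinuousLinearMap.id ℝ (Cn n)

def IsJHolomorphicOn (n : ℕ) (Ω : Set (Cn n)) (J : Cn n → (Cn n →L[ℝ] Cn n))
    (R : ℝ) (f : ℂ → Cn n) : Prop :=
  MapsTo f (ball (0:ℂ) R) Ω ∧
    ∀ z ∈ ball (0:ℂ) R, DifferentiableAt ℝ f z ∧
      ∀ ξ : ℂ, fderiv ℝ f z (Complex.I * ξ) = J (f z) (fderiv ℝ f z ξ)

def kobayashiRoyden (n : ℕ) (Ω : Set (Cn n)) (J : Cn n → (Cn n →L[ℝ] Cn n))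
    (p v : Cn n) : ℝ≥0∞ :=
  sInf {c : ℝ≥0∞ | ∃ r : ℝ, 0 < r ∧
    (∃ f : ℂ → Cn n, IsJHolomorphicOn n Ω J 1 f ∧ f 0 = p ∧ fderiv ℝ f 0 1 = r • v) ∧
    c = ENNReal.ofReal (1 / r)}

/-- The inverse hyperbolic tangent, `arctanh x = ½ log((1 + x)/(1 - x))`. -/
def arctanh (x : ℝ) : ℝ := (1 / 2) * Real.log ((1 + x) / (1 - x))

/-- The Poincaré distance on the unit disc. -/
def poincareDist (z w : ℂ) : ℝ :=
  arctanh (‖z - w‖ / ‖1 - (starRingEnd ℂ) z * w‖)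

/-- The Kobayashi pseudodistance `d_Ω(p, q)` of the almost complex manifold `(Ω, J)`. -/
def kobayashiDist (n : ℕ) (Ω : Set (Cn n)) (J : Cn n → (Cn n →L[ℝ] Cn n))
    (p q : Cn n) : ℝ≥0∞ :=
  sInf {c : ℝ≥0∞ | ∃ m : ℕ, ∃ z w : Fin (m + 1) → ℂ, ∃ f : Fin (m + 1) → ℂ → Cn n,
    (∀ k, z k ∈ ball (0:ℂ) 1 ∧ w k ∈ ball (0:ℂ) 1 ∧ IsJHolomorphicOn n Ω J 1 (f k)) ∧
    f 0 (z 0) = p ∧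
    (∀ k : Fin m, f k.castSucc (w k.castSucc) = f k.succ (z k.succ)) ∧
    f (Fin.last m) (w (Fin.last m)) = q ∧
    c = ENNReal.ofReal (∑ k, poincareDist (z k) (w k))}

/-- `γ` is a piecewise continuously differentiable path in `Ω`, parametrized by `[0,1]`. -/
def IsPiecewiseC1PathIn (n : ℕ) (Ω : Set (Cn n)) (γ : ℝ → Cn n) : Prop :=
  ContinuousOn γ (Icc (0:ℝ) 1) ∧ MapsTo γ (Icc (0:ℝ) 1) Ω ∧
    ∃ (k : ℕ) (t : Fin (k + 1) → ℝ), StrictMono t ∧ t 0 = 0 ∧ t (Fin.last k) = 1 ∧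
      ∀ i : Fin k, ContDiffOn ℝ 1 γ (Icc (t i.castSucc) (t i.succ))

/-- The Kobayashi–Royden length `∫₀¹ F_Ω(γ(t), γ′(t)) dt` of a path. -/
def kobayashiRoydenLength (n : ℕ) (Ω : Set (Cn n)) (J : Cn n → (Cn n →L[ℝ] Cn n))
    (γ : ℝ → Cn n) : ℝ≥0∞ :=
  ∫⁻ t in Icc (0:ℝ) 1, kobayashiRoyden n Ω J (γ t) (deriv γ t)

/-- The integrated Kobayashi–Royden pseudodistance `d̄_Ω(p, q)`. -/
def integratedKRDist (n : ℕ) (Ω : Set (Cn n)) (J : Cn n → (Cn n →L[ℝ] Cn n))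
    (p q : Cn n) : ℝ≥0∞ :=
  ⨅ γ : {γ : ℝ → Cn n // IsPiecewiseC1PathIn n Ω γ ∧ γ 0 = p ∧ γ 1 = q},
    kobayashiRoydenLength n Ω J γ

namespace KR
open scoped NNReal BoundedContinuousFunction

def wt (k : ℤ × ℤ) : ℝ≥0 := 1 + ‖k.1‖₊ + ‖k.2‖₊

lemma one_le_wt (k : ℤ × ℤ) : 1 ≤ wt k := by
  unfold wt; rw [add_assoc]; exact le_self_add

lemma wt_add (k l : ℤ × ℤ) : wt (k + l) ≤ wt k * wt l := by
  rw [← NNReal.coe_le_coe]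
  simp only [wt, Prod.fst_add, Prod.snd_add, NNReal.coe_add, NNReal.coe_mul, NNReal.coe_one, coe_nnnorm]
  have h1 := norm_add_le k.1 l.1
  have h2 := norm_add_le k.2 l.2
  have a1 := norm_nonneg k.1
  have a2 := norm_nonneg k.2
  have a3 := norm_nonneg l.1
  have a4 := norm_nonneg l.2
  nlinarith [mul_nonneg a1 a3, mul_nonneg a1 a4, mul_nonneg a2 a3, mul_nonneg a2 a4]

lemma wt_neg (k : ℤ × ℤ) : wt (-k) = wt k := by simp [wt]

lemma wt_sub (k l : ℤ × ℤ) : wt (k - l) ≤ wt k * wt l := by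
  rw [sub_eq_add_neg]; exact (wt_add _ _).trans (by rw [wt_neg])

/-- phase -/
def ph (k : ℤ × ℤ) (z : ℂ) : ℝ := 2 * Real.pi * (k.1 * z.re + k.2 * z.im)

def atm (k : ℤ × ℤ) (θ : ℝ) (z : ℂ) : ℝ := Real.cos (ph k z + θ)

lemma abs_atm_le (k : ℤ × ℤ) (θ : ℝ) (z : ℂ) : ‖atm k θ z‖ ≤ 1 := by
  rw [Real.norm_eq_abs]; exact Real.abs_cos_le_one _

lemma atm_mul (k l : ℤ × ℤ) (θ η : ℝ) (z : ℂ) :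
    atm k θ z * atm l η z = (1/2) * atm (k + l) (θ + η) z + (1/2) * atm (k - l) (θ - η) z := by
  have h1 : ph (k + l) z + (θ + η) = (ph k z + θ) + (ph l z + η) := by
    simp only [ph, Prod.fst_add, Prod.snd_add]; push_cast; ring
  have h2 : ph (k - l) z + (θ - η) = (ph k z + θ) - (ph l z + η) := by
    simp only [ph, Prod.fst_sub, Prod.snd_sub]; push_cast; ring
  simp only [atm]
  rw [h1, h2, Real.cos_add (ph k z + θ), Real.cos_sub (ph k z + θ)]; ring

section
variable {E : Type} [NormedAddCommGroup E] [NormedSpace ℝ E]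
variable {E' : Type} [NormedAddCommGroup E'] [NormedSpace ℝ E']
variable {E'' : Type} [NormedAddCommGroup E''] [NormedSpace ℝ E'']

def WA (s : ℕ) (F : ℂ → E) (C : ℝ≥0) : Prop :=
  ∃ (ι : Type) (k : ι → ℤ × ℤ) (θ : ι → ℝ) (a : ι → E),
    (∑' i, ((wt (k i) ^ s * ‖a i‖₊ : ℝ≥0) : ℝ≥0∞) ≤ C) ∧
    ∀ z, HasSum (fun i => atm (k i) (θ i) z • a i) (F z)

lemma summable_of_le {ι : Type} {f : ι → ℝ≥0} {C : ℝ≥0} (h : ∑' i, (f i : ℝ≥0∞) ≤ C) :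
    Summable f := by
  rw [← ENNReal.tsum_coe_ne_top_iff_summable]
  exact ne_top_of_le_ne_top ENNReal.coe_ne_top h

lemma tsum_le_of_le {ι : Type} {f : ι → ℝ≥0} {C : ℝ≥0} (h : ∑' i, (f i : ℝ≥0∞) ≤ C) :
    ∑' i, f i ≤ C := by
  rw [← ENNReal.coe_le_coe, ENNReal.coe_tsum (summable_of_le h)]; exact h

lemma WA.mono {s s' : ℕ} {F : ℂ → E} {C C' : ℝ≥0} (h : WA s F C) (hs : s' ≤ s) (hC : C ≤ C') :
    WA s' F C' := by
  obtain ⟨ι, k, θ, a, h1, h2⟩ := h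
  refine ⟨ι, k, θ, a, le_trans (ENNReal.tsum_le_tsum fun i => ?_) (h1.trans (by exact_mod_cast hC)), h2⟩
  have := pow_le_pow_right₀ (one_le_wt (k i)) hs
  norm_cast
  gcongr

lemma WA.norm_le {s : ℕ} {F : ℂ → E} {C : ℝ≥0} (h : WA s F C) (z : ℂ) : ‖F z‖ ≤ C := by
  obtain ⟨ι, k, θ, a, h1, h2⟩ := h.mono (Nat.zero_le s) le_rfl
  simp only [pow_zero, one_mul] at h1
  have hs := summable_of_le h1
  have hs' : Summable (fun i => ‖a i‖) := by
    have := NNReal.summable_coe.2 hs; simpa using this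
  have h3 : HasSum (fun i => ‖a i‖) (∑' i, ‖a i‖) := hs'.hasSum
  have h4 : ‖F z‖ ≤ ∑' i, ‖a i‖ := by
    rw [← (h2 z).tsum_eq]
    refine tsum_of_norm_bounded h3 fun i => ?_
    rw [norm_smul]
    exact mul_le_of_le_one_left (norm_nonneg _) (abs_atm_le _ _ _)
  refine h4.trans ?_
  have := tsum_le_of_le h1
  rw [← NNReal.coe_le_coe, NNReal.coe_tsum] at this
  simpa using this

lemma WA.const (s : ℕ) (c : E) : WA s (fun _ => c) ‖c‖₊ := by
  refine ⟨Unit, fun _ => 0, fun _ => 0, fun _ => c, ?_, fun z => ?_⟩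
  · simp [wt]
  · have := hasSum_unique (fun _ : Unit => atm 0 0 z • c)
    simpa [atm, ph] using this

lemma WA.add {s : ℕ} {F G : ℂ → E} {C D : ℝ≥0} (h : WA s F C) (h' : WA s G D) :
    WA s (fun z => F z + G z) (C + D) := by
  obtain ⟨ι, k, θ, a, h1, h2⟩ := h
  obtain ⟨ι', k', θ', a', h1', h2'⟩ := h'
  refine ⟨ι ⊕ ι', Sum.elim k k', Sum.elim θ θ', Sum.elim a a', ?_, fun z => ?_⟩
  · rw [Summable.tsum_sum ENNReal.summable ENNReal.summable]
    simp only [Sum.elim_inl, Sum.elim_inr, ENNReal.coe_add]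
    exact add_le_add h1 h1'
  · refine HasSum.sum ?_ ?_
    · simpa [Function.comp_def] using h2 z
    · simpa [Function.comp_def] using h2' z

lemma WA.bilin {s : ℕ} {F : ℂ → E} {G : ℂ → E'} {C D : ℝ≥0} (h : WA s F C) (h' : WA s G D)
    [CompleteSpace E'']
    (B : E →L[ℝ] E' →L[ℝ] E'') :
    WA s (fun z => B (F z) (G z)) (‖B‖₊ * C * D) := by
  obtain ⟨ι, k, θ, a, h1, h2⟩ := h
  obtain ⟨ι', k', θ', a', h1', h2'⟩ := h'
  let c : ι × ι' → E'' := fun p => (1/2 : ℝ) • B (a p.1) (a' p.2)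
  have hc : ∀ p, ‖c p‖₊ ≤ (1/2) * (‖B‖₊ * ‖a p.1‖₊ * ‖a' p.2‖₊) := by
    intro p
    rw [← NNReal.coe_le_coe]
    simp only [c, coe_nnnorm, norm_smul, NNReal.coe_mul]
    have := B.le_opNorm₂ (a p.1) (a' p.2)
    norm_num
    linarith
  let kk : (ι × ι') ⊕ (ι × ι') → ℤ × ℤ := Sum.elim (fun p => k p.1 + k' p.2) (fun p => k p.1 - k' p.2)
  let tt : (ι × ι') ⊕ (ι × ι') → ℝ := Sum.elim (fun p => θ p.1 + θ' p.2) (fun p => θ p.1 - θ' p.2)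
  let cc : (ι × ι') ⊕ (ι × ι') → E'' := Sum.elim c c
  have key : ∀ K : ι → ι' → ℤ × ℤ, (∀ i j, wt (K i j) ≤ wt (k i) * wt (k' j)) →
      ∑' p : ι × ι', ((wt (K p.1 p.2) ^ s * ‖c p‖₊ : ℝ≥0) : ℝ≥0∞) ≤ ((1/2 * (‖B‖₊ * C * D) : ℝ≥0) : ℝ≥0∞) := by
    intro K hK
    calc ∑' p : ι × ι', ((wt (K p.1 p.2) ^ s * ‖c p‖₊ : ℝ≥0) : ℝ≥0∞)
        ≤ ∑' p : ι × ι', (((1/2 * ‖B‖₊ : ℝ≥0) : ℝ≥0∞) * (((wt (k p.1) ^ s * ‖a p.1‖₊ : ℝ≥0) : ℝ≥0∞) *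
            ((wt (k' p.2) ^ s * ‖a' p.2‖₊ : ℝ≥0) : ℝ≥0∞))) := by
          refine ENNReal.tsum_le_tsum fun p => ?_
          norm_cast
          calc wt (K p.1 p.2) ^ s * ‖c p‖₊ ≤ (wt (k p.1) * wt (k' p.2)) ^ s *
                ((1/2) * (‖B‖₊ * ‖a p.1‖₊ * ‖a' p.2‖₊)) := by
                gcongr
                · exact hK _ _
                · exact hc p
            _ = _ := by rw [mul_pow]; ring
      _ = ((1/2 * ‖B‖₊ : ℝ≥0) : ℝ≥0∞) * ((∑' i, ((wt (k i) ^ s * ‖a i‖₊ : ℝ≥0) : ℝ≥0∞)) *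
            (∑' i, ((wt (k' i) ^ s * ‖a' i‖₊ : ℝ≥0) : ℝ≥0∞))) := by
          rw [ENNReal.tsum_mul_left, ENNReal.tsum_prod']
          congr 1
          rw [← ENNReal.tsum_mul_right]
          refine tsum_congr fun i => ?_
          simp only []
          rw [ENNReal.tsum_mul_left]
      _ ≤ ((1/2 * ‖B‖₊ : ℝ≥0) : ℝ≥0∞) * (C * D) := by gcongr
      _ = _ := by push_cast; ring
  have k1 := key (fun i j => k i + k' j) (fun i j => wt_add _ _)
  have k2 := key (fun i j => k i - k' j) (fun i j => wt_sub _ _)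
  have hT : ∑' p, ((wt (kk p) ^ s * ‖cc p‖₊ : ℝ≥0) : ℝ≥0∞) ≤ ((‖B‖₊ * C * D : ℝ≥0) : ℝ≥0∞) := by
    rw [Summable.tsum_sum ENNReal.summable ENNReal.summable]
    simp only [kk, cc, Sum.elim_inl, Sum.elim_inr]
    refine (add_le_add k1 k2).trans (le_of_eq ?_)
    rw [← ENNReal.coe_add, ← add_mul, add_halves, one_mul]
  refine ⟨_, kk, tt, cc, hT, fun z => ?_⟩
  have hsumm : Summable (fun p => atm (kk p) (tt p) z • cc p) := by
    have hs := summable_of_le hT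
    have hs2 : Summable (fun p => ‖cc p‖) := by
      have := NNReal.summable_coe.2 (NNReal.summable_of_le (fun p => ?_) hs : Summable (fun p => ‖cc p‖₊))
      · simpa using this
      · exact le_mul_of_one_le_left zero_le (one_le_pow₀ (one_le_wt _))
    refine Summable.of_norm_bounded hs2 fun p => ?_
    rw [norm_smul]
    exact mul_le_of_le_one_left (norm_nonneg _) (abs_atm_le _ _ _)
  have hl : Summable (fun p : ι × ι' => atm (k p.1 + k' p.2) (θ p.1 + θ' p.2) z • c p) := by
    exact hsumm.comp_injective (i := Sum.inl) Sum.inl_injective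
  have hr : Summable (fun p : ι × ι' => atm (k p.1 - k' p.2) (θ p.1 - θ' p.2) z • c p) := by
    exact hsumm.comp_injective (i := Sum.inr) Sum.inr_injective
  have hprod : HasSum (fun p : ι × ι' => atm (k p.1 + k' p.2) (θ p.1 + θ' p.2) z • c p +
      atm (k p.1 - k' p.2) (θ p.1 - θ' p.2) z • c p) (B (F z) (G z)) := by
    have hs0 := hl.add hr
    have e1 : ∀ p : ι × ι', atm (k p.1 + k' p.2) (θ p.1 + θ' p.2) z • c p +
      atm (k p.1 - k' p.2) (θ p.1 - θ' p.2) z • c p =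
      B (atm (k p.1) (θ p.1) z • a p.1) (atm (k' p.2) (θ' p.2) z • a' p.2) := by
      intro p
      simp only [c, map_smul, smul_apply, smul_smul]
      rw [← add_smul]
      congr 1
      have := atm_mul (k p.1) (k' p.2) (θ p.1) (θ' p.2) z
      linarith
    simp only [e1] at hs0 ⊢
    have h3 := hs0.hasSum
    have h4 : ∀ i, HasSum (fun j => B (atm (k i) (θ i) z • a i) (atm (k' j) (θ' j) z • a' j))
        (B (atm (k i) (θ i) z • a i) (G z)) := fun i => (B (atm (k i) (θ i) z • a i)).hasSum (h2' z)
    have h5 := h3.prod_fiberwise h4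
    have h6 : HasSum (fun i => B (atm (k i) (θ i) z • a i) (G z)) (B (F z) (G z)) :=
      (B.flip (G z)).hasSum (h2 z)
    rw [h6.unique h5]; exact h3
  have h7 := HasSum.sum (f := fun p => atm (kk p) (tt p) z • cc p) hl.hasSum hr.hasSum
  rwa [← hl.tsum_add hr, hprod.tsum_eq] at h7

lemma WA.clm {s : ℕ} {F : ℂ → E} {C : ℝ≥0} (h : WA s F C) (T : E →L[ℝ] E') :
    WA s (fun z => T (F z)) (‖T‖₊ * C) := by
  obtain ⟨ι, k, θ, a, h1, h2⟩ := h
  refine ⟨ι, k, θ, fun i => T (a i), ?_, fun z => ?_⟩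
  · calc _ ≤ ∑' i, (‖T‖₊ : ℝ≥0∞) * ((wt (k i) ^ s * ‖a i‖₊ : ℝ≥0) : ℝ≥0∞) := by
          refine ENNReal.tsum_le_tsum fun i => ?_
          norm_cast
          calc _ ≤ wt (k i) ^ s * (‖T‖₊ * ‖a i‖₊) := by gcongr; exact T.le_opNNNorm _
            _ = _ := by ring
      _ ≤ _ := by rw [ENNReal.tsum_mul_left, ENNReal.coe_mul]; gcongr
  · simpa using T.hasSum (h2 z)

lemma WA.smul {s : ℕ} {F : ℂ → E} {C : ℝ≥0} (h : WA s F C) (r : ℝ) :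
    WA s (fun z => r • F z) (‖r‖₊ * C) := by
  have := h.clm (r • ContinuousLinearMap.id ℝ E)
  refine this.mono le_rfl ?_
  gcongr
  refine ContinuousLinearMap.opNorm_le_bound _ (norm_nonneg r) fun x => ?_
  simp [norm_smul]

lemma WA.sub {s : ℕ} {F G : ℂ → E} {C D : ℝ≥0} (h : WA s F C) (h' : WA s G D) :
    WA s (fun z => F z - G z) (C + D) := by
  have := h.add (h'.smul (-1))
  simpa [sub_eq_add_neg] using this

lemma WA.periodic {s : ℕ} {F : ℂ → E} {C : ℝ≥0} (h : WA s F C) (m n : ℤ) (z : ℂ) :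
    F (z + (m + n * Complex.I)) = F z := by
  obtain ⟨ι, k, θ, a, h1, h2⟩ := h
  refine (h2 _).unique ?_
  convert! h2 z using 3 with i
  have : ph (k i) (z + (m + n * Complex.I)) + θ i = (ph (k i) z + θ i) + ((k i).1 * m + (k i).2 * n : ℤ) * (2 * Real.pi) := by
    simp [ph]; ring
  rw [atm, this, Real.cos_add_int_mul_two_pi, atm]

end
end KR

namespace KR
open scoped NNReal BoundedContinuousFunction

def lk (k : ℤ × ℤ) : ℂ →L[ℝ] ℝ :=
  (2 * Real.pi * k.1) • Complex.reCLM + (2 * Real.pi * k.2) • Complex.imCLM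

lemma lk_apply (k : ℤ × ℤ) (z : ℂ) : lk k z = ph k z := by
  simp [lk, ph]; ring

lemma norm_lk_le (k : ℤ × ℤ) : ‖lk k‖₊ ≤ 7 * wt k := by
  rw [← NNReal.coe_le_coe]
  refine ContinuousLinearMap.opNorm_le_bound _ (NNReal.coe_nonneg _) fun z => ?_
  rw [lk_apply, ph, Real.norm_eq_abs, abs_mul]
  have h1 : |(k.1 * z.re + k.2 * z.im : ℝ)| ≤ (|(k.1:ℝ)| + |(k.2:ℝ)|) * ‖z‖ := by
    refine (abs_add_le _ _).trans ?_
    rw [abs_mul, abs_mul, add_mul]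
    gcongr
    · exact Complex.abs_re_le_norm z
    · exact Complex.abs_im_le_norm z
  have h2 : |2 * Real.pi| ≤ 7 := by
    rw [abs_of_pos Real.two_pi_pos]; have := Real.pi_lt_d2; linarith
  have h3 : |(k.1:ℝ)| + |(k.2:ℝ)| ≤ wt k := by
    simp only [wt, NNReal.coe_add, NNReal.coe_one, coe_nnnorm, Int.norm_eq_abs]; linarith
  calc _ ≤ 7 * ((|(k.1:ℝ)| + |(k.2:ℝ)|) * ‖z‖) := by gcongr
    _ ≤ 7 * (wt k * ‖z‖) := by gcongr
    _ = _ := by push_cast; ring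

lemma hasFDerivAt_atm (k : ℤ × ℤ) (θ : ℝ) (z : ℂ) :
    HasFDerivAt (atm k θ) (atm k (θ + Real.pi / 2) z • lk k) z := by
  have h : HasFDerivAt (fun z => lk k z + θ) (lk k) z := (lk k).hasFDerivAt.add_const θ
  have h2 := h.cos
  have e1 : atm k θ = fun z => Real.cos (lk k z + θ) := by
    ext z; simp [atm, lk_apply]
  rw [e1]
  convert! h2 using 2
  rw [atm, lk_apply, ← add_assoc, Real.cos_add_pi_div_two]

section
variable {E : Type} [NormedAddCommGroup E] [NormedSpace ℝ E] [CompleteSpace E]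

lemma WA.fderiv {s : ℕ} {F : ℂ → E} {C : ℝ≥0} (h : WA (s+1) F C) :
    Differentiable ℝ F ∧ WA s (fderiv ℝ F) (7 * C) := by
  obtain ⟨ι, k, θ, a, h1, h2⟩ := h
  have hF : F = fun z => ∑' i, atm (k i) (θ i) z • a i := by
    ext z; exact (h2 z).tsum_eq.symm
  let a' : ι → (ℂ →L[ℝ] E) := fun i => (lk (k i)).smulRight (a i)
  have ha' : ∀ i, ‖a' i‖₊ ≤ 7 * (wt (k i) * ‖a i‖₊) := by
    intro i
    have : ‖a' i‖₊ ≤ ‖lk (k i)‖₊ * ‖a i‖₊ := by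
      rw [← NNReal.coe_le_coe]; simp [a', ContinuousLinearMap.norm_smulRight_apply]
    refine this.trans ?_
    rw [← mul_assoc]; gcongr; exact norm_lk_le _
  have hT : ∑' i, ((wt (k i) ^ s * ‖a' i‖₊ : ℝ≥0) : ℝ≥0∞) ≤ ((7 * C : ℝ≥0) : ℝ≥0∞) := by
    calc _ ≤ ∑' i, ((7:ℝ≥0) : ℝ≥0∞) * ((wt (k i) ^ (s+1) * ‖a i‖₊ : ℝ≥0) : ℝ≥0∞) := by
          refine ENNReal.tsum_le_tsum fun i => ?_
          norm_cast
          calc _ ≤ wt (k i) ^ s * (7 * (wt (k i) * ‖a i‖₊)) := by gcongr; exact ha' i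
            _ = _ := by ring
      _ ≤ _ := by rw [ENNReal.tsum_mul_left, ENNReal.coe_mul]; gcongr
  have hs := summable_of_le hT
  have hs2 : Summable (fun i => ‖a' i‖) := by
    have := NNReal.summable_coe.2 (NNReal.summable_of_le (fun p => ?_) hs : Summable (fun p => ‖a' p‖₊))
    · simpa using this
    · exact le_mul_of_one_le_left zero_le (one_le_pow₀ (one_le_wt _))
  have hb : ∀ i z, ‖atm (k i) (θ i + Real.pi / 2) z • a' i‖ ≤ ‖a' i‖ := by
    intro i z; rw [norm_smul]
    exact mul_le_of_le_one_left (norm_nonneg _) (abs_atm_le _ _ _)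
  have hd : ∀ z, HasFDerivAt F (∑' i, atm (k i) (θ i + Real.pi / 2) z • a' i) z := by
    intro z
    rw [hF]
    refine hasFDerivAt_tsum (𝕜 := ℝ) hs2 (fun i z => ?_) hb (h2 0).summable z
    have := (hasFDerivAt_atm (k i) (θ i) z).smul_const (a i)
    convert! this using 1
    ext; simp [a', smul_smul, mul_comm]
  refine ⟨fun z => (hd z).differentiableAt, ι, k, fun i => θ i + Real.pi/2, a', hT, fun z => ?_⟩
  rw [(hd z).fderiv]
  exact (Summable.of_norm_bounded hs2 fun i => hb i z).hasSum

end

lemma WA.contDiff (m : ℕ) : ∀ {E : Type} [NormedAddCommGroup E] [NormedSpace ℝ E] [CompleteSpace E]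
    {F : ℂ → E} {C : ℝ≥0}, WA m F C → 
    ContDiff ℝ m F ∧ ∀ z, ‖iteratedFDeriv ℝ m F z‖ ≤ 7 ^ m * C := by
  induction m with
  | zero =>
    intro E _ _ _ F C h
    refine ⟨?_, fun z => by simpa using h.norm_le z⟩
    obtain ⟨ι, k, θ, a, h1, h2⟩ := h
    have hF : F = fun z => ∑' i, atm (k i) (θ i) z • a i := by
      ext z; exact (h2 z).tsum_eq.symm
    simp only [pow_zero, one_mul] at h1
    have hs := NNReal.summable_coe.2 (summable_of_le h1)
    rw [Nat.cast_zero, contDiff_zero, hF]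
    refine continuous_tsum (fun i => ?_) hs fun i z => ?_
    · have : Continuous (atm (k i) (θ i)) :=
        continuous_iff_continuousAt.2 fun z => (hasFDerivAt_atm _ _ z).continuousAt
      fun_prop
    · rw [norm_smul]
      exact mul_le_of_le_one_left (norm_nonneg _) (abs_atm_le _ _ _)
  | succ m ih =>
    intro E _ _ _ F C h
    obtain ⟨hd, h'⟩ := h.fderiv
    obtain ⟨i1, i2⟩ := ih h'
    refine ⟨?_, fun z => ?_⟩
    · push_cast
      rw [contDiff_succ_iff_fderiv]
      exact ⟨hd, by simp, i1⟩
    · rw [← norm_iteratedFDeriv_fderiv]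
      refine (i2 z).trans (le_of_eq ?_)
      push_cast; ring

end KR

namespace KR
open scoped NNReal BoundedContinuousFunction

def ex (k : ℤ × ℤ) (z : ℂ) : ℂ := Complex.exp ((ph k z : ℂ) * Complex.I)

lemma norm_ex (k : ℤ × ℤ) (z : ℂ) : ‖ex k z‖ = 1 := Complex.norm_exp_ofReal_mul_I _

lemma continuous_ph (k : ℤ × ℤ) : Continuous (ph k) := by
  unfold ph; fun_prop

lemma continuous_ex (k : ℤ × ℤ) : Continuous (ex k) := by
  have := continuous_ph k
  unfold ex; fun_prop

lemma ex_add (k l : ℤ × ℤ) (z : ℂ) : ex (k + l) z = ex k z * ex l z := by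
  rw [ex, ex, ex, ← Complex.exp_add]
  congr 1
  simp only [ph, Prod.fst_add, Prod.snd_add]; push_cast; ring

lemma atm_eq (k : ℤ × ℤ) (θ : ℝ) (z : ℂ) : (atm k θ z : ℂ) =
    (1/2) * (Complex.exp (θ * Complex.I) * ex k z + Complex.exp (-(θ * Complex.I)) * ex (-k) z) := by
  rw [atm, Complex.ofReal_cos, Complex.cos, ex, ex, ← Complex.exp_add, ← Complex.exp_add]
  have : ph (-k) z = - ph k z := by simp [ph]; ring
  rw [this]; push_cast
  rw [show (θ : ℂ) * Complex.I + ph k z * Complex.I = (ph k z + θ) * Complex.I by ring,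
    show -((θ : ℂ) * Complex.I) + -(ph k z : ℂ) * Complex.I = -(ph k z + θ : ℂ) * Complex.I by ring]
  ring

def e1 (n : ℤ) (x : ℝ) : ℂ := Complex.exp ((2 * Real.pi * n * x : ℝ) * Complex.I)

lemma continuous_e1 (n : ℤ) : Continuous (e1 n) := by unfold e1; fun_prop

lemma integral_e1 (n : ℤ) : ∫ x in (0:ℝ)..1, e1 n x = if n = 0 then 1 else 0 := by
  split_ifs with h
  · simp [h, e1]
  · have hc : (2 * Real.pi * n * Complex.I : ℂ) ≠ 0 := by
      simp [h, Real.pi_ne_zero]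
    have : ∀ x : ℝ, e1 n x = Complex.exp ((2 * Real.pi * n * Complex.I) * x) := by
      intro x; rw [e1]; congr 1; push_cast; ring
    simp_rw [this]
    rw [integral_exp_mul_complex hc]
    have h2 : Complex.exp (2 * Real.pi * n * Complex.I * (1:ℝ)) = 1 := by
      rw [Complex.exp_eq_one_iff]; exact ⟨n, by push_cast; ring⟩
    rw [h2]; simp

lemma ex_eq (k : ℤ × ℤ) (x y : ℝ) : ex k (x + y * Complex.I) = e1 k.1 x * e1 k.2 y := by
  rw [ex, e1, e1, ← Complex.exp_add]
  congr 1
  simp [ph]; ring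

section
variable {E : Type} [NormedAddCommGroup E] [NormedSpace ℝ E] [NormedSpace ℂ E] [IsScalarTower ℝ ℂ E]

def cf (F : ℂ → E) (k : ℤ × ℤ) : E :=
  ∫ x in (0:ℝ)..1, ∫ y in (0:ℝ)..1, ex (-k) (x + y * Complex.I) • F (x + y * Complex.I)

lemma cont_aux {F : ℂ → E} (hF : Continuous F) (k : ℤ × ℤ) :
    Continuous (fun p : ℝ × ℝ => ex (-k) (p.1 + p.2 * Complex.I) • F (p.1 + p.2 * Complex.I)) := by
  have := continuous_ex (-k)
  fun_prop

lemma cont_aux2 {F : ℂ → E} (hF : Continuous F) (k : ℤ × ℤ) :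
    Continuous (fun x : ℝ => ∫ y in (0:ℝ)..1, ex (-k) (x + y * Complex.I) • F (x + y * Complex.I)) :=
  intervalIntegral.continuous_parametric_intervalIntegral_of_continuous' (μ := MeasureTheory.volume)
    (f := fun (x y : ℝ) => ex (-k) (x + y * Complex.I) • F (x + y * Complex.I)) (cont_aux hF k) 0 1

lemma cont_aux1 {F : ℂ → E} (hF : Continuous F) (k : ℤ × ℤ) (x : ℝ) :
    Continuous (fun y : ℝ => ex (-k) (x + y * Complex.I) • F (x + y * Complex.I)) := 
  (cont_aux hF k).comp (by fun_prop : Continuous (fun y : ℝ => (x, y)))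

lemma cf_add {F G : ℂ → E} (hF : Continuous F) (hG : Continuous G) (k : ℤ × ℤ) :
    cf (fun z => F z + G z) k = cf F k + cf G k := by
  unfold cf
  rw [← intervalIntegral.integral_add ((cont_aux2 hF k).intervalIntegrable _ _) ((cont_aux2 hG k).intervalIntegrable _ _)]
  congr 1; ext x
  rw [← intervalIntegral.integral_add ((cont_aux1 hF k x).intervalIntegrable _ _) ((cont_aux1 hG k x).intervalIntegrable _ _)]
  simp [smul_add]

lemma cf_clm [CompleteSpace E] {E' : Type} [NormedAddCommGroup E'] [NormedSpace ℝ E'] [NormedSpace ℂ E'] [IsScalarTower ℝ ℂ E']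
    [CompleteSpace E'] (T : E →L[ℂ] E')
    {F : ℂ → E} (hF : Continuous F) (k : ℤ × ℤ) :
    cf (fun z => T (F z)) k = T (cf F k) := by
  unfold cf
  have h1 := ((T.restrictScalars ℝ)).intervalIntegral_comp_comm ((cont_aux2 hF k).intervalIntegrable (μ := MeasureTheory.volume) 0 1)
  simp only [ContinuousLinearMap.coe_restrictScalars'] at h1
  rw [← h1]
  congr 1; ext x
  have h2 := ((T.restrictScalars ℝ)).intervalIntegral_comp_comm ((cont_aux1 hF k x).intervalIntegrable (μ := MeasureTheory.volume) 0 1)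
  simp only [ContinuousLinearMap.coe_restrictScalars'] at h2
  rw [← h2]
  simp

lemma cf_smul {F : ℂ → E} (c : ℂ) (k : ℤ × ℤ) :
    cf (fun z => c • F z) k = c • cf F k := by
  unfold cf
  simp_rw [smul_comm _ c, intervalIntegral.integral_smul]

lemma cf_sub {F G : ℂ → E} (hF : Continuous F) (hG : Continuous G) (k : ℤ × ℤ) :
    cf (fun z => F z - G z) k = cf F k - cf G k := by
  have := cf_add hF (hG.const_smul (-1 : ℂ)) k
  have h2 : cf (fun z => (-1 : ℂ) • G z) k = _ := cf_smul (-1) k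
  change _ = _ + cf (fun z => (-1 : ℂ) • G z) k at this
  rw [h2] at this
  simpa [sub_eq_add_neg] using this

lemma norm_cf_le {F : ℂ → E} {C : ℝ} (hF : ∀ z, ‖F z‖ ≤ C) (k : ℤ × ℤ) : ‖cf F k‖ ≤ C := by
  have h1 : ∀ x : ℝ, ‖∫ y in (0:ℝ)..1, ex (-k) (x + y * Complex.I) • F (x + y * Complex.I)‖ ≤ C := by
    intro x
    have := intervalIntegral.norm_integral_le_of_norm_le_const (a := (0:ℝ)) (b := 1) (C := C)
      (f := fun y : ℝ => ex (-k) (x + y * Complex.I) • F (x + y * Complex.I)) (fun y _ => by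
        rw [norm_smul, norm_ex, one_mul]; exact hF _)
    simpa using this
  have := intervalIntegral.norm_integral_le_of_norm_le_const (a := (0:ℝ)) (b := 1) (C := C)
      (f := fun x : ℝ => ∫ y in (0:ℝ)..1, ex (-k) (x + y * Complex.I) • F (x + y * Complex.I)) (fun x _ => h1 x)
  simpa [cf] using this

def cfL (k : ℤ × ℤ) : (ℂ →ᵇ E) →L[ℝ] E :=
  LinearMap.mkContinuous
    { toFun := fun F => cf F k
      map_add' := fun F G => by
        have := cf_add F.continuous G.continuous k
        exact this
      map_smul' := fun r F => by
        have := cf_smul (F := F) (r : ℂ) k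
        simp only [RingHom.id_apply]
        have h : ∀ x : E, (r : ℂ) • x = r • x := fun x => by
          exact algebraMap_smul ℂ r x
        simp only [h] at this
        exact this } 1
    (fun F => by
      rw [one_mul]; exact norm_cf_le (fun z => F.norm_coe_le_norm z) k)


lemma cf_hasSum [CompleteSpace E] {ι : Type} (u : ι → (ℂ →ᵇ E)) (hu : Summable (fun i => ‖u i‖))
    {F : ℂ → E} (hF : ∀ z, HasSum (fun i => u i z) (F z)) (m : ℤ × ℤ) :
    Continuous F ∧ HasSum (fun i => cf (u i) m) (cf F m) := by
  have hs : HasSum u (∑' i, u i) := (Summable.of_norm hu).hasSum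
  have hF' : F = ⇑(∑' i, u i) := by
    ext z
    refine (hF z).unique ?_
    exact (BoundedContinuousFunction.evalCLM ℝ z).hasSum hs
  refine ⟨by rw [hF']; exact (∑' i, u i).continuous, ?_⟩
  have := (cfL m).hasSum hs
  rw [hF']; exact this

lemma cf_ex (k m : ℤ × ℤ) (a : E) [CompleteSpace E] :
    cf (fun z => ex k z • a) m = (if m = k then (1:ℂ) else 0) • a := by
  have h : cf (fun z => ex k z) m = if m = k then (1:ℂ) else 0 := by
    unfold cf
    have : ∀ x y : ℝ, ex (-m) (x + y * Complex.I) • ex k (x + y * Complex.I) = e1 (k - m).1 x * e1 (k - m).2 y := by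
      intro x y
      rw [← ex_eq, smul_eq_mul, ← ex_add]; congr 1; abel
    simp_rw [this, intervalIntegral.integral_const_mul, intervalIntegral.integral_mul_const, integral_e1]
    simp only [Prod.fst_sub, Prod.snd_sub, sub_eq_zero, ← ite_and, mul_ite, mul_one, mul_zero]
    have : m = k ↔ k.1 = m.1 ∧ k.2 = m.2 := by rw [Prod.ext_iff]; constructor <;> rintro ⟨h1, h2⟩ <;> exact ⟨h1.symm, h2.symm⟩
    by_cases hmk : m = k
    · simp [hmk]
    · rw [if_neg hmk]; rw [this] at hmk; split_ifs <;> tauto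
  have h2 := cf_clm ((ContinuousLinearMap.toSpanSingleton ℂ a)) (continuous_ex k) m
  simp only [ContinuousLinearMap.toSpanSingleton_apply] at h2
  rw [h2, h]

lemma cf_atm [CompleteSpace E] (k m : ℤ × ℤ) (θ : ℝ) (a : E) :
    ‖cf (fun z => atm k θ z • a) m‖₊ ≤ (if m = k then (1/2:ℝ≥0) else 0) * ‖a‖₊ + (if m = -k then (1/2:ℝ≥0) else 0) * ‖a‖₊ := by
  have h1 : (fun z => atm k θ z • a) = fun z => ((1/2) * Complex.exp (θ * Complex.I)) • (ex k z • a) +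
      ((1/2) * Complex.exp (-(θ * Complex.I))) • (ex (-k) z • a) := by
    ext z
    have h : (atm k θ z : ℂ) • a = atm k θ z • a := algebraMap_smul ℂ (atm k θ z) a
    rw [← h, atm_eq, smul_smul, smul_smul, ← add_smul]; congr 1; ring
  have c1 : ∀ k, Continuous (fun z => ex k z • a) := fun k => (continuous_ex k).smul continuous_const
  have c2 : ∀ (c : ℂ) k, Continuous (fun z => c • (ex k z • a)) := fun c k => (c1 k).const_smul c
  rw [h1, cf_add (c2 _ _) (c2 _ _), cf_smul, cf_smul, cf_ex, cf_ex]
  have n1 : ‖Complex.exp (θ * Complex.I)‖ = 1 := Complex.norm_exp_ofReal_mul_I _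
  have n2 : ‖Complex.exp (-(θ * Complex.I))‖ = 1 := by
    have := Complex.norm_exp_ofReal_mul_I (-θ)
    simpa using this
  rw [← NNReal.coe_le_coe]
  refine (norm_add_le _ _).trans ?_
  simp only [norm_smul, norm_mul, n1, n2, NNReal.coe_add, NNReal.coe_mul, coe_nnnorm, mul_one]
  refine add_le_add (le_of_eq ?_) (le_of_eq ?_) <;> split_ifs <;> simp

def bAtm (k : ℤ × ℤ) (θ : ℝ) (a : E) : ℂ →ᵇ E :=
  BoundedContinuousFunction.ofNormedAddCommGroup (fun z => atm k θ z • a) (by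
    have := continuous_ph k
    unfold atm; fun_prop) ‖a‖ (fun z => by
    rw [norm_smul]; exact mul_le_of_le_one_left (norm_nonneg _) (abs_atm_le _ _ _))

lemma norm_bAtm (k : ℤ × ℤ) (θ : ℝ) (a : E) : ‖bAtm k θ a‖ ≤ ‖a‖ :=
  (BoundedContinuousFunction.norm_le (norm_nonneg _)).2 fun z => by
    change ‖atm k θ z • a‖ ≤ ‖a‖
    rw [norm_smul]; exact mul_le_of_le_one_left (norm_nonneg _) (abs_atm_le _ _ _)

def bEx (k : ℤ × ℤ) (a : E) : ℂ →ᵇ E :=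
  BoundedContinuousFunction.ofNormedAddCommGroup (fun z => ex k z • a) (by
    have := continuous_ex k
    fun_prop) ‖a‖ (fun z => by
    rw [norm_smul, norm_ex, one_mul])

lemma norm_bEx (k : ℤ × ℤ) (a : E) : ‖bEx k a‖ ≤ ‖a‖ :=
  (BoundedContinuousFunction.norm_le (norm_nonneg _)).2 fun z => by
    change ‖ex k z • a‖ ≤ ‖a‖
    rw [norm_smul, norm_ex, one_mul]

lemma WA.cf_le [CompleteSpace E] {s : ℕ} {F : ℂ → E} {C : ℝ≥0} (h : WA s F C) :
    ∑' m, ((wt m ^ s * ‖cf F m‖₊ : ℝ≥0) : ℝ≥0∞) ≤ C := by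
  have h0 := h.mono (Nat.zero_le s) le_rfl
  obtain ⟨ι, k, θ, a, h1, h2⟩ := h
  have hs2 : Summable (fun i => ‖a i‖) := by
    have := NNReal.summable_coe.2 (NNReal.summable_of_le (fun p => ?_) (summable_of_le h1) : Summable (fun p => ‖a p‖₊))
    · simpa using this
    · exact le_mul_of_one_le_left zero_le (one_le_pow₀ (one_le_wt _))
  have key : ∀ m, HasSum (fun i => cf (fun z => atm (k i) (θ i) z • a i) m) (cf F m) := fun m =>
    (cf_hasSum (fun i => bAtm (k i) (θ i) (a i))
      (Summable.of_nonneg_of_le (fun i => norm_nonneg _) (fun i => norm_bAtm _ _ _) hs2) h2 m).2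
  have key2 : ∀ m, (‖cf F m‖₊ : ℝ≥0∞) ≤ ∑' i, ((((if m = k i then (1/2:ℝ≥0) else 0) * ‖a i‖₊ + (if m = -k i then (1/2:ℝ≥0) else 0) * ‖a i‖₊ : ℝ≥0)) : ℝ≥0∞) := by
    intro m
    rw [← (key m).tsum_eq]
    change ‖(_ : E)‖ₑ ≤ _
    refine le_trans (enorm_tsum_le_tsum_enorm) (ENNReal.tsum_le_tsum fun i => ?_)
    exact_mod_cast cf_atm (k i) m (θ i) (a i)
  calc _ ≤ ∑' m, ∑' i, (((wt m ^ s : ℝ≥0) : ℝ≥0∞) * ((((if m = k i then (1/2:ℝ≥0) else 0) * ‖a i‖₊ + (if m = -k i then (1/2:ℝ≥0) else 0) * ‖a i‖₊ : ℝ≥0)) : ℝ≥0∞)) := by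
        refine ENNReal.tsum_le_tsum fun m => ?_
        rw [ENNReal.tsum_mul_left, ENNReal.coe_mul]
        gcongr
        exact key2 m
    _ = ∑' i, ∑' m, (((wt m ^ s : ℝ≥0) : ℝ≥0∞) * ((((if m = k i then (1/2:ℝ≥0) else 0) * ‖a i‖₊ + (if m = -k i then (1/2:ℝ≥0) else 0) * ‖a i‖₊ : ℝ≥0)) : ℝ≥0∞)) := ENNReal.tsum_comm
    _ ≤ ∑' i, ((wt (k i) ^ s * ‖a i‖₊ : ℝ≥0) : ℝ≥0∞) := by
        refine ENNReal.tsum_le_tsum fun i => ?_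
        have e : ∀ m, (((wt m ^ s : ℝ≥0) : ℝ≥0∞) * ((((if m = k i then (1/2:ℝ≥0) else 0) * ‖a i‖₊ + (if m = -k i then (1/2:ℝ≥0) else 0) * ‖a i‖₊ : ℝ≥0)) : ℝ≥0∞)) =
          (if m = k i then ((wt m ^ s * (1/2 * ‖a i‖₊) : ℝ≥0) : ℝ≥0∞) else 0) + (if m = - k i then ((wt m ^ s * (1/2 * ‖a i‖₊) : ℝ≥0) : ℝ≥0∞) else 0) := by
          intro m
          split_ifs <;> simp <;> ring
        simp_rw [e]
        rw [ENNReal.tsum_add, tsum_ite_eq, tsum_ite_eq, wt_neg, ← ENNReal.coe_add, ← mul_add, ← add_mul, add_halves, one_mul]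
    _ ≤ C := h1

end
end KR

namespace KR
open scoped NNReal BoundedContinuousFunction

def Per {E : Type} (F : ℂ → E) : Prop := (∀ z, F (z + 1) = F z) ∧ ∀ z, F (z + Complex.I) = F z

lemma fourier_zero (g : ℝ → ℂ) (hg : Continuous g) (hp : Function.Periodic g 1)
    (h : ∀ n : ℤ, ∫ x in (0:ℝ)..1, e1 (-n) x * g x = 0) (x : ℝ) : g x = 0 := by
  have : Fact (0 < (1:ℝ)) := ⟨one_pos⟩
  let G : C(AddCircle (1:ℝ), ℂ) := ⟨hp.lift, by
    exact ((QuotientAddGroup.isQuotientMap_mk _).continuous_iff).2 hg⟩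
  have hG : ∀ y : ℝ, G (y : AddCircle (1:ℝ)) = g y := fun y => rfl
  have hc : ∀ n, fourierCoeff G n = 0 := by
    intro n
    rw [fourierCoeff_eq_intervalIntegral _ n 0]
    simp only [zero_add, one_div, inv_one, one_smul]
    rw [← h n]
    congr 1; ext y
    rw [hG, fourier_coe_apply, smul_eq_mul, e1]
    congr 2; push_cast; ring
  have hs : Summable (fourierCoeff G) := by
    have : fourierCoeff (T := 1) G = fun _ => 0 := funext hc
    rw [this]; exact summable_zero
  have := has_pointwise_sum_fourier_series_of_summable hs (x : AddCircle (1:ℝ))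
  simp only [hc, zero_smul] at this
  rw [← hG x]
  exact this.unique hasSum_zero

lemma cf_zero_scalar {G : ℂ → ℂ} (hG : Continuous G) (hp : Per G) (h : ∀ k, cf G k = 0) (z : ℂ) :
    G z = 0 := by
  have hH : ∀ (l : ℤ) (x : ℝ), ∫ y in (0:ℝ)..1, e1 (-l) y * G (x + y * Complex.I) = 0 := by
    intro l
    refine fourier_zero _ ?_ ?_ ?_
    · have := continuous_e1 (-l)
      refine intervalIntegral.continuous_parametric_intervalIntegral_of_continuous' (μ := MeasureTheory.volume)
        (f := fun (x y : ℝ) => e1 (-l) y * G (x + y * Complex.I)) ?_ 0 1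
      simp only [Function.uncurry_def]
      fun_prop
    · intro x
      simp only
      congr 1; ext y
      have := hp.1 (x + y * Complex.I)
      rw [← this]; congr 2; push_cast; ring
    · intro n
      rw [← h (n, l), cf]
      congr 1; ext x
      rw [← intervalIntegral.integral_const_mul]
      congr 1; ext y
      rw [ex_eq, smul_eq_mul]; simp [mul_assoc]
  have := fourier_zero (fun y => G (z.re + y * Complex.I)) (by fun_prop) (by
    intro y; have := hp.2 (z.re + y * Complex.I); simp only; rw [← this]; congr 1; push_cast; ring) (fun l => hH l z.re) z.im
  simpa using this

section
variable {E : Type} [NormedAddCommGroup E] [NormedSpace ℝ E] [NormedSpace ℂ E] [IsScalarTower ℝ ℂ E]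
  [CompleteSpace E]

lemma ex_per (k : ℤ × ℤ) : Per (ex k) := by
  constructor
  · intro z
    rw [ex, ex, Complex.exp_eq_exp_iff_exists_int]
    exact ⟨k.1, by simp [ph]; ring⟩
  · intro z
    rw [ex, ex, Complex.exp_eq_exp_iff_exists_int]
    exact ⟨k.2, by simp [ph]; ring⟩

lemma cf_series {c : ℤ × ℤ → E} (hc : Summable (fun k => ‖c k‖)) :
    Continuous (fun z => ∑' k, ex k z • c k) ∧ Per (fun z => ∑' k, ex k z • c k) ∧
    (∀ z, HasSum (fun k => ex k z • c k) (∑' k, ex k z • c k)) ∧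
    ∀ m, cf (fun z => ∑' k, ex k z • c k) m = c m := by
  have hS : ∀ z, HasSum (fun k => ex k z • c k) (∑' k, ex k z • c k) := fun z =>
    (Summable.of_norm_bounded hc (fun k => by rw [norm_smul, norm_ex, one_mul])).hasSum
  have key := fun m => cf_hasSum (fun k => bEx k (c k))
      (Summable.of_nonneg_of_le (fun i => norm_nonneg _) (fun i => norm_bEx _ _) hc) hS m
  refine ⟨(key 0).1, ⟨fun z => ?_, fun z => ?_⟩, hS, fun m => ?_⟩
  · simp only [(ex_per _).1]
  · simp only [(ex_per _).2]
  · have h := (key m).2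
    have e : ∀ k, cf (bEx k (c k)) m = if k = m then c k else 0 := by
      intro k
      have := cf_ex k m (c k)
      change cf (fun z => ex k z • c k) m = _
      rw [this]
      by_cases hk : k = m
      · simp [hk]
      · rw [if_neg hk, if_neg (fun h => hk h.symm), zero_smul]
    simp only [e] at h
    have e2 : (fun k => if k = m then c k else 0) = fun k => if k = m then c m else 0 := by
      ext k; split_ifs with hk
      · rw [hk]
      · rfl
    rw [e2] at h
    exact h.unique (hasSum_ite_eq m (c m))

lemma inversion {F : ℂ → E} (hF : Continuous F) (hp : Per F) (hs : Summable (fun k => ‖cf F k‖)) (z : ℂ) :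
    HasSum (fun k => ex k z • cf F k) (F z) := by
  obtain ⟨c1, c2, c3, c4⟩ := cf_series hs
  have : F z = ∑' k, ex k z • cf F k := by
    rw [← sub_eq_zero]
    refine (SeparatingDual.eq_zero_of_forall_dual_eq_zero (R := ℂ)) fun φ => ?_
    have hcont : Continuous (fun z => F z - ∑' k, ex k z • cf F k) := hF.sub c1
    refine cf_zero_scalar (G := fun z => φ (F z - ∑' k, ex k z • cf F k)) (by fun_prop) ?_ ?_ z
    · constructor <;> intro z
      · simp only [hp.1, c2.1]
      · simp only [hp.2, c2.2]
    · intro k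
      rw [cf_clm φ hcont, cf_sub hF c1, c4, sub_self, map_zero]
  rw [this]; exact c3 z

lemma WA.per {E : Type} [NormedAddCommGroup E] [NormedSpace ℝ E] {s : ℕ} {F : ℂ → E} {C : ℝ≥0} (h : WA s F C) : Per F := by
  constructor
  · intro z; simpa using h.periodic 1 0 z
  · intro z; simpa using h.periodic 0 1 z

lemma summable_norm_iff_nn {ι : Type} {c : ι → E} (h : Summable (fun k => ‖c k‖₊)) : Summable (fun k => ‖c k‖) := by
  have := NNReal.summable_coe.2 h
  simpa using this

lemma ex_smul_eq (k : ℤ × ℤ) (z : ℂ) (c : E) :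
    ex k z • c = atm k 0 z • c + atm k (-(Real.pi/2)) z • (Complex.I • c) := by
  have : ex k z = (atm k 0 z : ℂ) + (atm k (-(Real.pi/2)) z : ℂ) * Complex.I := by
    rw [ex, Complex.exp_mul_I, atm, atm, add_zero, ← sub_eq_add_neg, Real.cos_sub_pi_div_two]
    push_cast; rfl
  have hr : ∀ (r : ℝ) (x : E), (r : ℂ) • x = r • x := fun r x => algebraMap_smul ℂ r x
  rw [this, add_smul, mul_smul, hr, hr]

/-- series with summable coefficients is in the algebra -/
lemma WA.of_series {s : ℕ} {F : ℂ → E} {c : ℤ × ℤ → E} {C : ℝ≥0}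
    (hF : ∀ z, HasSum (fun k => ex k z • c k) (F z))
    (hc : ∑' m, ((wt m ^ s * ‖c m‖₊ : ℝ≥0) : ℝ≥0∞) ≤ C) : WA s F (2 * C) := by
  have hs : Summable (fun k => ‖c k‖) := by
    have h1 := summable_of_le hc
    have : Summable (fun k => ‖c k‖₊) := NNReal.summable_of_le (fun k => by
      calc ‖c k‖₊ = 1 * ‖c k‖₊ := (one_mul _).symm
        _ ≤ _ := by gcongr; exact one_le_pow₀ (one_le_wt k)) h1
    exact summable_norm_iff_nn this
  refine ⟨(ℤ × ℤ) ⊕ (ℤ × ℤ), Sum.elim id id, Sum.elim (fun _ => 0) (fun _ => -(Real.pi/2)),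
    Sum.elim c (fun k => Complex.I • c k), ?_, fun z => ?_⟩
  · rw [ENNReal.summable.tsum_sum ENNReal.summable]
    simp only [Sum.elim_inl, Sum.elim_inr, id, nnnorm_smul, Complex.nnnorm_I, one_mul]
    rw [two_mul]; push_cast
    exact add_le_add (by simpa using hc) (by simpa using hc)
  · have h1 : Summable (fun k => atm k 0 z • c k) := Summable.of_norm_bounded hs (fun k => by
      rw [norm_smul]; exact mul_le_of_le_one_left (norm_nonneg _) (abs_atm_le _ _ _))
    have h2 : Summable (fun k => atm k (-(Real.pi/2)) z • (Complex.I • c k)) := Summable.of_norm_bounded hs (fun k => by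
      rw [norm_smul, norm_smul, Complex.norm_I, one_mul]; exact mul_le_of_le_one_left (norm_nonneg _) (abs_atm_le _ _ _))
    have e := (h1.hasSum.add h2.hasSum)
    simp only [← ex_smul_eq] at e
    rw [(hF z).unique e]
    exact HasSum.sum (f := fun i : (ℤ × ℤ) ⊕ (ℤ × ℤ) => atm (Sum.elim id id i) (Sum.elim (fun _ => 0) (fun _ => -(Real.pi/2)) i) z • Sum.elim c (fun k => Complex.I • c k) i) h1.hasSum h2.hasSum

lemma WA.of_cf {s : ℕ} {F : ℂ → E} (hF : Continuous F) (hp : Per F) {C : ℝ≥0}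
    (hc : ∑' m, ((wt m ^ s * ‖cf F m‖₊ : ℝ≥0) : ℝ≥0∞) ≤ C) : WA s F (2 * C) := by
  refine WA.of_series (fun z => inversion hF hp ?_ z) hc
  have h1 := summable_of_le hc
  have : Summable (fun k => ‖cf F k‖₊) := NNReal.summable_of_le (fun k => by
    calc ‖cf F k‖₊ = 1 * ‖cf F k‖₊ := (one_mul _).symm
      _ ≤ _ := by gcongr; exact one_le_pow₀ (one_le_wt k)) h1
  exact summable_norm_iff_nn this

end
end KR

namespace KR
open scoped NNReal BoundedContinuousFunction
section
variable {E : Type} [NormedAddCommGroup E] [NormedSpace ℝ E] [NormedSpace ℂ E] [IsScalarTower ℝ ℂ E]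
  [CompleteSpace E]

lemma hasDerivAt_e1 (n : ℤ) (x : ℝ) : HasDerivAt (e1 n) ((2 * Real.pi * n * Complex.I) * e1 n x) x := by
  have h1 : HasDerivAt (fun x : ℝ => ((2 * Real.pi * n * x : ℝ) : ℂ) * Complex.I)
      (2 * Real.pi * n * Complex.I) x := by
    have h0 : HasDerivAt (fun x : ℝ => 2 * Real.pi * n * x) (2 * Real.pi * n) x := by
      simpa using (hasDerivAt_id x).const_mul (2 * Real.pi * n)
    have := h0.ofReal_comp.mul_const Complex.I
    push_cast at this ⊢
    exact this
  have := h1.cexp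
  rw [mul_comm]; exact this

lemma parts1 {G G' : ℝ → E} (hG : ∀ x, HasDerivAt G (G' x) x) (hG' : Continuous G') (h01 : G 1 = G 0) (n : ℤ) :
    ∫ x in (0:ℝ)..1, e1 (-n) x • G' x = (2 * Real.pi * n * Complex.I : ℂ) • ∫ x in (0:ℝ)..1, e1 (-n) x • G x := by
  have hc : Continuous G := continuous_iff_continuousAt.2 fun x => (hG x).continuousAt
  have he := continuous_e1 (-n)
  have hd : ∀ x ∈ uIcc (0:ℝ) 1, HasDerivAt (fun x => e1 (-n) x • G x)
      (e1 (-n) x • G' x + ((2 * Real.pi * (-n : ℤ) * Complex.I) * e1 (-n) x) • G x) x := fun x _ =>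
    (hasDerivAt_e1 (-n) x).smul (hG x)
  have h := intervalIntegral.integral_eq_sub_of_hasDerivAt hd
    (Continuous.intervalIntegrable (by fun_prop) _ _)
  rw [intervalIntegral.integral_add (Continuous.intervalIntegrable (by fun_prop) _ _)
    (Continuous.intervalIntegrable (by fun_prop) _ _)] at h
  have e0 : e1 (-n) 1 = e1 (-n) 0 := by
    rw [e1, e1, Complex.exp_eq_exp_iff_exists_int]
    exact ⟨-n, by push_cast; ring⟩
  rw [e0, h01, sub_self] at h
  rw [eq_neg_of_add_eq_zero_left h, ← intervalIntegral.integral_smul, ← intervalIntegral.integral_neg]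
  congr 1; ext x
  rw [← neg_smul, smul_smul]; congr 1; push_cast; ring

lemma cf_swap {F : ℂ → E} (hF : Continuous F) (k : ℤ × ℤ) :
    cf F k = ∫ y in (0:ℝ)..1, ∫ x in (0:ℝ)..1, ex (-k) (x + y * Complex.I) • F (x + y * Complex.I) := by
  unfold cf
  rw [MeasureTheory.intervalIntegral_intervalIntegral_swap]
  have := (cont_aux hF k)
  refine (this.continuousOn.integrableOn_compact (isCompact_Icc.prod isCompact_Icc : IsCompact (Icc (0:ℝ) 1 ×ˢ Icc (0:ℝ) 1))).mono_set ?_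
  refine prod_mono ?_ ?_ <;> · rw [uIoc_of_le zero_le_one]; exact Ioc_subset_Icc_self

lemma cf_fderiv_one {F : ℂ → E} (hF : ContDiff ℝ 1 F) (hp : Per F) (k : ℤ × ℤ) :
    cf (fun z => fderiv ℝ F z 1) k = (2 * Real.pi * k.1 * Complex.I : ℂ) • cf F k := by
  have hc : Continuous (fderiv ℝ F) := hF.continuous_fderiv one_ne_zero
  rw [cf_swap (by fun_prop), cf_swap hF.continuous, ← intervalIntegral.integral_smul]
  congr 1; ext y
  have := parts1 (G := fun x : ℝ => e1 (-k.2) y • F (x + y * Complex.I)) (G' := fun x : ℝ => e1 (-k.2) y • fderiv ℝ F (x + y * Complex.I) 1)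
    (fun x => by
      refine HasDerivAt.const_smul _ ?_
      have h1 : HasFDerivAt F (fderiv ℝ F (x + y * Complex.I)) (x + y * Complex.I) :=
        (hF.differentiable one_ne_zero _).hasFDerivAt
      have h2 : HasDerivAt (fun x : ℝ => (x : ℂ) + y * Complex.I) 1 x := by
        simpa using (hasDerivAt_id x).ofReal_comp.add_const (y * Complex.I : ℂ)
      exact h1.comp_hasDerivAt x h2) (by fun_prop) (by
      have := hp.1 (y * Complex.I); push_cast; rw [zero_add, ← this, add_comm]) k.1
  simp only [mul_smul (e1 _ _), ex_eq]
  exact this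

lemma cf_fderiv_I {F : ℂ → E} (hF : ContDiff ℝ 1 F) (hp : Per F) (k : ℤ × ℤ) :
    cf (fun z => fderiv ℝ F z Complex.I) k = (2 * Real.pi * k.2 * Complex.I : ℂ) • cf F k := by
  have hc : Continuous (fderiv ℝ F) := hF.continuous_fderiv one_ne_zero
  unfold cf
  rw [← intervalIntegral.integral_smul]
  congr 1; ext x
  have := parts1 (G := fun y : ℝ => e1 (-k.1) x • F (x + y * Complex.I)) (G' := fun y : ℝ => e1 (-k.1) x • fderiv ℝ F (x + y * Complex.I) Complex.I)
    (fun y => by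
      refine HasDerivAt.const_smul _ ?_
      have h1 : HasFDerivAt F (fderiv ℝ F (x + y * Complex.I)) (x + y * Complex.I) :=
        (hF.differentiable one_ne_zero _).hasFDerivAt
      have h2 : HasDerivAt (fun y : ℝ => (x : ℂ) + y * Complex.I) Complex.I y := by
        simpa using ((hasDerivAt_id y).ofReal_comp.mul_const Complex.I).const_add (x : ℂ)
      exact h1.comp_hasDerivAt y h2) (by fun_prop) (by
      have := hp.2 x; push_cast; rw [one_mul, this, zero_mul, add_zero]) k.2
  simp only [ex_eq, mul_comm (e1 _ x), mul_smul (e1 _ _)]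
  exact this

/-- complex linear evaluation -/
def evC (v : ℂ) : (ℂ →L[ℝ] E) →L[ℂ] E :=
  LinearMap.mkContinuous { toFun := fun T => T v, map_add' := fun _ _ => rfl, map_smul' := fun _ _ => rfl } ‖v‖
    (fun T => by rw [mul_comm]; exact T.le_opNorm v)

lemma cf_eval {G : ℂ → (ℂ →L[ℝ] E)} (hG : Continuous G) (v : ℂ) (k : ℤ × ℤ) :
    cf (fun z => G z v) k = cf G k v := cf_clm (evC v) hG k

lemma cf_fderiv_le {F : ℂ → E} (hF : ContDiff ℝ 1 F) (hp : Per F) (k : ℤ × ℤ) :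
    (‖k.1‖ + ‖k.2‖) * ‖cf F k‖ ≤ 2 * ‖cf (fderiv ℝ F) k‖ := by
  have hc : Continuous (fderiv ℝ F) := hF.continuous_fderiv one_ne_zero
  have h1 := cf_fderiv_one hF hp k
  have h2 := cf_fderiv_I hF hp k
  rw [cf_eval hc] at h1 h2
  have b1 : ‖cf (fderiv ℝ F) k 1‖ ≤ ‖cf (fderiv ℝ F) k‖ := by
    simpa using (cf (fderiv ℝ F) k).le_opNorm 1
  have b2 : ‖cf (fderiv ℝ F) k Complex.I‖ ≤ ‖cf (fderiv ℝ F) k‖ := by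
    simpa using (cf (fderiv ℝ F) k).le_opNorm Complex.I
  have aux : ∀ (n : ℤ), ‖n‖ * ‖cf F k‖ ≤ ‖(2 * Real.pi * n * Complex.I : ℂ) • cf F k‖ := by
    intro n
    rw [norm_smul]; gcongr
    rw [norm_mul, norm_mul, Complex.norm_I, mul_one]
    have e1 : ‖(n : ℂ)‖ = ‖n‖ := by simp [Int.norm_eq_abs]
    have e2 : 1 ≤ ‖(2 * Real.pi : ℂ)‖ := by
      rw [norm_mul]; simp
      rw [abs_of_pos Real.pi_pos]; linarith [Real.pi_gt_three]
    rw [e1]; exact le_mul_of_one_le_left (norm_nonneg _) e2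
  have := aux k.1; have := aux k.2
  rw [← h1] at *; rw [← h2] at *
  linarith

lemma per_fderiv {E : Type} [NormedAddCommGroup E] [NormedSpace ℝ E] {F : ℂ → E} (hp : Per F) : Per (fderiv ℝ F) := by
  constructor
  · intro z
    rw [← fderiv_comp_add_right]; congr 1; ext1 w; exact hp.1 w
  · intro z
    rw [← fderiv_comp_add_right]; congr 1; ext1 w; exact hp.2 w

end

lemma cf_iter_le (j : ℕ) : ∀ {E : Type} [NormedAddCommGroup E] [NormedSpace ℝ E] [NormedSpace ℂ E] [IsScalarTower ℝ ℂ E]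
    [CompleteSpace E] {F : ℂ → E} (hF : ContDiff ℝ j F) (hp : Per F) {C : ℝ}
    (hC : ∀ z, ‖iteratedFDeriv ℝ j F z‖ ≤ C) (k : ℤ × ℤ),
    (‖k.1‖ + ‖k.2‖) ^ j * ‖cf F k‖ ≤ 2 ^ j * C := by
  induction j with
  | zero =>
    intro E _ _ _ _ _ F hF hp C hC k
    simp only [pow_zero, one_mul]
    exact norm_cf_le (fun z => by simpa using hC z) k
  | succ j ih =>
    intro E _ _ _ _ _ F hF hp C hC k
    have h1 : ContDiff ℝ j (fderiv ℝ F) := hF.fderiv_right (by norm_cast)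
    have h2 := ih h1 (per_fderiv hp) (C := C) (fun z => by rw [norm_iteratedFDeriv_fderiv]; exact hC z) k
    have h3 := cf_fderiv_le (hF.of_le (by norm_cast; omega)) hp k
    calc (‖k.1‖ + ‖k.2‖) ^ (j+1) * ‖cf F k‖ = (‖k.1‖ + ‖k.2‖) ^ j * ((‖k.1‖ + ‖k.2‖) * ‖cf F k‖) := by ring
      _ ≤ (‖k.1‖ + ‖k.2‖) ^ j * (2 * ‖cf (fderiv ℝ F) k‖) := by gcongr
      _ = 2 * ((‖k.1‖ + ‖k.2‖) ^ j * ‖cf (fderiv ℝ F) k‖) := by ring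
      _ ≤ 2 * (2 ^ j * C) := by gcongr
      _ = _ := by ring

lemma summable_wt : Summable (fun k : ℤ × ℤ => ((wt k ^ 3)⁻¹ : ℝ≥0)) := by
  have h := EisensteinSeries.summable_one_div_norm_rpow (k := 3) (by norm_num)
  have h' := (finTwoArrowEquiv ℤ).symm.summable_iff.2 h
  rw [← NNReal.summable_coe]
  refine Summable.of_norm_bounded_eventually h' ?_
  have : ({0} : Set (ℤ × ℤ))ᶜ ∈ cofinite := (finite_singleton 0).compl_mem_cofinite
  filter_upwards [this] with k hk
  simp only [Function.comp]
  have hn : 0 < ‖(finTwoArrowEquiv ℤ).symm k‖ := by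
    rw [norm_pos_iff]
    intro h0
    apply hk
    have h00 := congrFun h0 0; have h01 := congrFun h0 1
    simp at h00 h01
    simp [Prod.ext_iff, h00, h01]
  have hle : ‖(finTwoArrowEquiv ℤ).symm k‖ ≤ wt k := by
    rw [pi_norm_le_iff_of_nonneg (by positivity)]
    intro i
    have a1 := norm_nonneg k.1
    have a2 := norm_nonneg k.2
    fin_cases i <;> simp [wt] <;> linarith
  rw [Real.norm_of_nonneg (by positivity)]
  push_cast
  have e : ‖(finTwoArrowEquiv ℤ).symm k‖ ^ (-3 : ℝ) = (‖(finTwoArrowEquiv ℤ).symm k‖ ^ 3)⁻¹ := by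
    rw [Real.rpow_neg hn.le]; norm_cast
  rw [e]
  gcongr

lemma base_WA : ∃ K : ℝ≥0, ∀ {E : Type} [NormedAddCommGroup E] [NormedSpace ℝ E] [NormedSpace ℂ E] [IsScalarTower ℝ ℂ E]
    [CompleteSpace E] {F : ℂ → E} (_ : ContDiff ℝ 3 F) (_ : Per F) {C : ℝ≥0}
    (_ : ∀ z, ‖F z‖ ≤ C) (_ : ∀ z, ‖iteratedFDeriv ℝ 3 F z‖ ≤ C), WA 0 F (K * C) := by
  refine ⟨2 * (36 * ∑' k : ℤ × ℤ, (wt k ^ 3)⁻¹), ?_⟩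
  intro E _ _ _ _ _ F hF hp C h0 h3
  rw [mul_assoc]
  refine WA.of_cf hF.continuous hp ?_
  have key : ∀ k, ‖cf F k‖₊ ≤ 36 * (wt k ^ 3)⁻¹ * C := by
    intro k
    have b3 := cf_iter_le 3 hF hp h3 k
    have b0 := norm_cf_le h0 k
    have : wt k ^ 3 * ‖cf F k‖₊ ≤ 36 * C := by
      rw [← NNReal.coe_le_coe]
      push_cast
      have ew : (wt k : ℝ) = 1 + (‖k.1‖ + ‖k.2‖) := by simp [wt, add_assoc]
      rw [ew]
      set t := ‖k.1‖ + ‖k.2‖ with ht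
      have t0 : 0 ≤ t := by positivity
      have : (1 + t) ^ 3 ≤ 4 * (1 + t ^ 3) := by nlinarith [sq_nonneg (t - 1), mul_nonneg t0 (sq_nonneg (t-1))]
      calc (1 + t) ^ 3 * ‖cf F k‖ ≤ (4 * (1 + t ^ 3)) * ‖cf F k‖ := by gcongr
        _ = 4 * (‖cf F k‖ + t ^ 3 * ‖cf F k‖) := by ring
        _ ≤ 4 * (C + 2 ^ 3 * C) := by gcongr
        _ = _ := by ring
    have hw : wt k ^ 3 ≠ 0 := pow_ne_zero _ (ne_of_gt (lt_of_lt_of_le one_pos (one_le_wt k)))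
    calc ‖cf F k‖₊ = (wt k ^ 3)⁻¹ * (wt k ^ 3 * ‖cf F k‖₊) := by rw [← mul_assoc, inv_mul_cancel₀ hw, one_mul]
      _ ≤ (wt k ^ 3)⁻¹ * (36 * C) := by gcongr
      _ = _ := by ring
  calc ∑' m, ((wt m ^ 0 * ‖cf F m‖₊ : ℝ≥0) : ℝ≥0∞) ≤ ∑' m, ((36 * (wt m ^ 3)⁻¹ * C : ℝ≥0) : ℝ≥0∞) := by
        refine ENNReal.tsum_le_tsum fun m => ?_
        rw [pow_zero, one_mul]; exact_mod_cast key m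
    _ = _ := by
        have hs : Summable (fun m => 36 * (wt m ^ 3)⁻¹ * C) := (summable_wt.mul_left 36).mul_right C
        rw [← ENNReal.coe_tsum hs, NNReal.tsum_mul_right, NNReal.tsum_mul_left]

lemma step_WA {E : Type} [NormedAddCommGroup E] [NormedSpace ℝ E] [NormedSpace ℂ E] [IsScalarTower ℝ ℂ E]
    [CompleteSpace E] {F : ℂ → E} (hF : ContDiff ℝ 1 F) {s : ℕ} {C D : ℝ≥0} (h : WA s F C)
    (h' : WA s (fderiv ℝ F) D) : WA (s+1) F (2 * (C + 2 * D)) := by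
  refine WA.of_cf hF.continuous h.per ?_
  have a := h.cf_le
  have b := h'.cf_le
  calc ∑' m, ((wt m ^ (s+1) * ‖cf F m‖₊ : ℝ≥0) : ℝ≥0∞)
      ≤ ∑' m, (((wt m ^ s * ‖cf F m‖₊ : ℝ≥0) : ℝ≥0∞) + 2 * ((wt m ^ s * ‖cf (fderiv ℝ F) m‖₊ : ℝ≥0) : ℝ≥0∞)) := by
        refine ENNReal.tsum_le_tsum fun m => ?_
        norm_cast
        rw [← NNReal.coe_le_coe]
        push_cast
        have ew : (wt m : ℝ) = 1 + (‖m.1‖ + ‖m.2‖) := by simp [wt, add_assoc]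
        have hb := cf_fderiv_le hF h.per m
        have hw : (0:ℝ) ≤ wt m ^ s := by positivity
        have := mul_le_mul_of_nonneg_left hb hw
        rw [pow_succ]; nth_rw 2 [ew]
        nlinarith
    _ ≤ _ := by
        rw [ENNReal.tsum_add, ENNReal.tsum_mul_left, ENNReal.coe_add, ENNReal.coe_mul]
        exact add_le_add a (mul_le_mul_right b _)

end KR

namespace KR
open scoped NNReal BoundedContinuousFunction

lemma comp_base {V : Type} [NormedAddCommGroup V] [NormedSpace ℝ V] [CompleteSpace V] [ProperSpace V]
    {F' : Type} [NormedAddCommGroup F'] [NormedSpace ℝ F'] [NormedSpace ℂ F'] [IsScalarTower ℝ ℂ F'] [CompleteSpace F']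
    {N : V → F'} (hN : ContDiff ℝ (⊤ : ℕ∞) N) (R : ℝ≥0) :
    ∃ C : ℝ≥0, ∀ W : ℂ → V, WA 3 W R → WA 0 (fun z => N (W z)) C := by
  obtain ⟨K, hK⟩ := base_WA
  have hb : ∀ i : ℕ, ∃ c : ℝ, ∀ x ∈ closedBall (0:V) R, ‖iteratedFDeriv ℝ i N x‖ ≤ c := fun i =>
    (isCompact_closedBall (0:V) R).exists_bound_of_continuousOn
      (hN.continuous_iteratedFDeriv (m := i) (by exact_mod_cast le_top)).continuousOn
  choose c hc using hb
  let c0 : ℝ≥0 := Real.toNNReal (c 0) + Real.toNNReal (c 1) + Real.toNNReal (c 2) + Real.toNNReal (c 3)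
  have hc0 : ∀ i ≤ 3, ∀ x ∈ closedBall (0:V) R, ‖iteratedFDeriv ℝ i N x‖ ≤ c0 := by
    intro i hi x hx
    refine (hc i x hx).trans ?_
    have h0 := Real.le_coe_toNNReal (c 0)
    have h1 := Real.le_coe_toNNReal (c 1)
    have h2 := Real.le_coe_toNNReal (c 2)
    have h3 := Real.le_coe_toNNReal (c 3)
    have p0 := (Real.toNNReal (c 0)).2
    have p1 := (Real.toNNReal (c 1)).2
    have p2 := (Real.toNNReal (c 2)).2
    have p3 := (Real.toNNReal (c 3)).2
    simp only [NNReal.val_eq_coe] at p0 p1 p2 p3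
    simp only [c0]; push_cast
    interval_cases i <;> linarith
  refine ⟨K * (6 * (c0 + 1) * (7 * (R + 1)) ^ 3), fun W hW => ?_⟩
  have hmem : ∀ z, W z ∈ closedBall (0:V) R := fun z => by simpa using hW.norm_le z
  have hWc : ContDiff ℝ 3 W := (WA.contDiff 3 hW).1
  have hNc : ContDiff ℝ 3 N := contDiff_infty.1 hN 3
  have hone : (1:ℝ) ≤ (7 * (R + 1)) ^ 3 := by
    apply one_le_pow₀; have := R.2; simp only [NNReal.val_eq_coe] at this; linarith
  refine hK (hNc.comp hWc) ?_ (fun z => ?_) (fun z => ?_)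
  · constructor
    · intro z; simp only [Function.comp, hW.per.1]
    · intro z; simp only [Function.comp, hW.per.2]
  · have := hc0 0 (by norm_num) _ (hmem z)
    rw [norm_iteratedFDeriv_zero] at this
    refine this.trans ?_
    push_cast
    have := c0.2; simp only [NNReal.val_eq_coe] at this
    nlinarith
  · have := norm_iteratedFDeriv_comp_le (n := 3) hNc hWc (by norm_num) z (C := c0) (D := 7 * (R + 1))
      (fun i hi => hc0 i hi _ (hmem z)) (fun i h1 hi => by
        have h := (WA.contDiff i (hW.mono hi le_rfl)).2 z
        refine h.trans ?_
        rw [mul_pow]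
        gcongr
        calc (R : ℝ) ≤ R + 1 := by linarith
          _ = (R + 1) ^ 1 := by ring
          _ ≤ _ := pow_le_pow_right₀ (by have := R.2; simp only [NNReal.val_eq_coe] at this; linarith) h1)
    refine this.trans ?_
    push_cast
    gcongr
    · norm_num [Nat.factorial]
    · linarith

lemma WA.compo {V : Type} [NormedAddCommGroup V] [NormedSpace ℝ V]
    {F' : Type} [NormedAddCommGroup F'] [NormedSpace ℝ F'] [CompleteSpace F'] (s : ℕ) :
    ∃ K : ℝ≥0, ∀ (F : ℂ → (V →L[ℝ] F')) (G : ℂ → (ℂ →L[ℝ] V)) (C D : ℝ≥0), WA s F C → WA s G D →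
      WA s (fun z => (F z).comp (G z)) (K * C * D) := 
  ⟨_, fun _ _ _ _ h h' => h.bilin h' (ContinuousLinearMap.compL ℝ ℂ V F')⟩

lemma comp_WA {V : Type} [NormedAddCommGroup V] [NormedSpace ℝ V] [CompleteSpace V] [ProperSpace V] (s : ℕ) (hs : s ≤ 3) :
    ∀ {F' : Type} [NormedAddCommGroup F'] [NormedSpace ℝ F'] [NormedSpace ℂ F'] [IsScalarTower ℝ ℂ F'] [CompleteSpace F']
    {N : V → F'} (_ : ContDiff ℝ (⊤ : ℕ∞) N) (R : ℝ≥0),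
    ∃ C : ℝ≥0, ∀ W : ℂ → V, WA 3 W R → WA s (fun z => N (W z)) C := by
  induction s with
  | zero => intro F' _ _ _ _ _ N hN R; exact comp_base hN R
  | succ s ih =>
    intro F' _ _ _ _ _ N hN R
    have hN1 : ContDiff ℝ (⊤ : ℕ∞) (fderiv ℝ N) := hN.fderiv_right (by exact_mod_cast le_top)
    obtain ⟨C, hC⟩ := ih (by omega) hN R
    obtain ⟨D, hD⟩ := ih (by omega) hN1 R
    obtain ⟨K, hK⟩ := WA.compo (V := V) (F' := F') s
    refine ⟨2 * (C + 2 * (K * D * (7 * R))), fun W hW => ?_⟩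
    have hWc : ContDiff ℝ 3 W := (WA.contDiff 3 hW).1
    have hNc : ContDiff ℝ 3 N := contDiff_infty.1 hN 3
    refine step_WA ((hNc.comp hWc).of_le (by norm_num)) (hC W hW) ?_
    have h1 : WA s (fderiv ℝ W) (7 * R) := (WA.fderiv (s := s) (hW.mono (by omega) le_rfl)).2
    have h2 := hK _ _ _ _ (hD W hW) h1
    have e : fderiv ℝ (fun z => N (W z)) = fun z => (fderiv ℝ N (W z)).comp (fderiv ℝ W z) := by
      ext1 z
      exact fderiv_comp z (hNc.differentiable (by norm_num) _) (hWc.differentiable (by norm_num) _)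
    change WA s (fderiv ℝ (fun z => N (W z))) _
    rw [e]; exact h2

open scoped Convolution in
lemma param_smooth {P : Type} [NormedAddCommGroup P] [NormedSpace ℝ P]
    {F' : Type} [NormedAddCommGroup F'] [NormedSpace ℝ F'] [CompleteSpace F']
    {g : P × ℝ → F'} (hg : ContDiff ℝ (⊤ : ℕ∞) g) :
    ContDiff ℝ (⊤ : ℕ∞) (fun p => ∫ t in (0:ℝ)..1, g (p, t)) := by
  let χ : ContDiffBump (0:ℝ) := ⟨2, 3, by norm_num, by norm_num⟩
  let gg : P → ℝ → F' := fun p t => χ t • g (p, -t)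
  let f : ℝ → ℝ := (Ioc (0:ℝ) 1).indicator 1
  have hf : MeasureTheory.LocallyIntegrable f := by
    have : MeasureTheory.Integrable f := by
      rw [MeasureTheory.integrable_indicator_iff measurableSet_Ioc]
      exact MeasureTheory.integrableOn_const (by simp)
    exact this.locallyIntegrable
  have h := MeasureTheory.contDiffOn_convolution_right_with_param_comp (𝕜 := ℝ) (n := (⊤ : ℕ∞)) (μ := MeasureTheory.volume) (P := P)
    (ContinuousLinearMap.lsmul ℝ ℝ : ℝ →L[ℝ] F' →L[ℝ] F') (s := univ) (v := fun _ => (0:ℝ)) contDiffOn_const (f := f)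
    (g := gg) (k := closedBall 0 3) isOpen_univ (isCompact_closedBall _ _) (fun p x _ hx => by
      simp only [gg]
      rw [χ.zero_of_le_dist (by simp only [mem_closedBall, not_le] at hx; exact hx.le), zero_smul]) hf (by
      refine ContDiff.contDiffOn ?_
      have h1 : ContDiff ℝ (⊤ : ℕ∞) (fun q : P × ℝ => χ q.2 • g (q.1, -q.2)) := by
        refine (χ.contDiff.comp contDiff_snd).smul (hg.comp ?_)
        exact contDiff_fst.prodMk contDiff_snd.neg
      exact h1)
  rw [contDiffOn_univ] at h
  convert h using 1
  ext p
  rw [MeasureTheory.convolution, intervalIntegral.integral_of_le zero_le_one, ← MeasureTheory.integral_indicator measurableSet_Ioc]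
  congr 1; ext t
  simp only [f, gg, zero_sub, neg_neg, ContinuousLinearMap.lsmul_apply]
  by_cases ht : t ∈ Ioc (0:ℝ) 1
  · rw [indicator_of_mem ht, indicator_of_mem ht, χ.one_of_mem_closedBall]
    · simp
    · simp only [mem_closedBall, dist_zero_right, norm_neg, Real.norm_eq_abs]
      rw [abs_of_pos ht.1]; exact ht.2.trans (by norm_num [χ])
  · rw [indicator_of_notMem ht, indicator_of_notMem ht, zero_smul]

lemma hadamard {V : Type} [NormedAddCommGroup V] [NormedSpace ℝ V]
    {F' : Type} [NormedAddCommGroup F'] [NormedSpace ℝ F'] [CompleteSpace F']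
    {A : V → F'} (hA : ContDiff ℝ (⊤ : ℕ∞) A) :
    ∃ M : V × V → (V →L[ℝ] F'), ContDiff ℝ (⊤ : ℕ∞) M ∧ ∀ x y, A x - A y = M (x, y) (x - y) := by
  have hA1 : ContDiff ℝ (⊤ : ℕ∞) (fderiv ℝ A) := hA.fderiv_right (by exact_mod_cast le_top)
  have hg : ContDiff ℝ (⊤ : ℕ∞) (fun q : (V × V) × ℝ => fderiv ℝ A (q.1.2 + q.2 • (q.1.1 - q.1.2))) := by
    refine hA1.comp ?_
    fun_prop
  refine ⟨_, param_smooth hg, fun x y => ?_⟩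
  have hcont : Continuous (fun t : ℝ => fderiv ℝ A (y + t • (x - y))) := hA1.continuous.comp (by fun_prop)
  have hd : ∀ t ∈ uIcc (0:ℝ) 1, HasDerivAt (fun t : ℝ => A (y + t • (x - y))) (fderiv ℝ A (y + t • (x - y)) (x - y)) t := by
    intro t _
    have h1 : HasFDerivAt A (fderiv ℝ A (y + t • (x - y))) (y + t • (x - y)) :=
      (hA.differentiable (by simp) _).hasFDerivAt
    have h2 : HasDerivAt (fun t : ℝ => y + t • (x - y)) (x - y) t := by
      simpa using ((hasDerivAt_id t).smul_const (x - y)).const_add y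
    exact h1.comp_hasDerivAt t h2
  have h := intervalIntegral.integral_eq_sub_of_hasDerivAt hd
    (Continuous.intervalIntegrable (by fun_prop) _ _)
  simp only [one_smul, zero_smul, add_zero, add_sub_cancel] at h
  rw [← h]
  rw [ContinuousLinearMap.intervalIntegral_apply (hcont.intervalIntegrable _ _)]

lemma lip_WA {V : Type} [NormedAddCommGroup V] [NormedSpace ℝ V] [CompleteSpace V] [ProperSpace V]
    {F' : Type} [NormedAddCommGroup F'] [NormedSpace ℝ F'] [NormedSpace ℂ F'] [IsScalarTower ℝ ℂ F'] [CompleteSpace F']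
    {A : V → F'} (hA : ContDiff ℝ (⊤ : ℕ∞) A) (R : ℝ≥0) :
    ∃ C : ℝ≥0, ∀ (U U' : ℂ → V) (δ : ℝ≥0), WA 3 U R → WA 3 U' R → WA 3 (fun z => U z - U' z) δ →
      WA 3 (fun z => A (U z) - A (U' z)) (C * δ) := by
  obtain ⟨M, hM, hM'⟩ := hadamard hA
  obtain ⟨C, hC⟩ := comp_WA (V := V × V) 3 le_rfl hM
    (‖ContinuousLinearMap.inl ℝ V V‖₊ * R + ‖ContinuousLinearMap.inr ℝ V V‖₊ * R)
  refine ⟨‖ContinuousLinearMap.id ℝ (V →L[ℝ] F')‖₊ * C, fun U U' δ hU hU' hd => ?_⟩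
  have h := (hU.clm (ContinuousLinearMap.inl ℝ V V)).add (hU'.clm (ContinuousLinearMap.inr ℝ V V))
  simp only [ContinuousLinearMap.inl_apply, ContinuousLinearMap.inr_apply, Prod.mk_add_mk, add_zero, zero_add] at h
  have h2 := (hC _ h).bilin hd (ContinuousLinearMap.id ℝ (V →L[ℝ] F'))
  simpa only [hM', ContinuousLinearMap.id_apply] using h2

end KR

namespace KR
open scoped NNReal BoundedContinuousFunction

lemma exists_h : ∃ h : ℝ → ℝ, ContDiff ℝ (⊤ : ℕ∞) h ∧ ∀ x : ℝ, |x| < 1/100 → h (Real.sin (2 * Real.pi * x)) = x := by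
  let χ : ContDiffBump (0:ℝ) := ⟨1/4, 1/2, by norm_num, by norm_num⟩
  refine ⟨fun t => χ t * ((2 * Real.pi)⁻¹ * Real.arcsin t), ?_, ?_⟩
  · rw [contDiff_iff_contDiffAt]
    intro t
    by_cases ht : |t| < 3/4
    · have h1 : t ≠ -1 := by rintro rfl; norm_num at ht
      have h2 : t ≠ 1 := by rintro rfl; norm_num at ht
      exact χ.contDiff.contDiffAt.mul (contDiffAt_const.mul (Real.contDiffAt_arcsin h1 h2))
    · have hev : (fun t => χ t * ((2 * Real.pi)⁻¹ * Real.arcsin t)) =ᶠ[𝓝 t] fun _ => 0 := by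
        have ho : {u : ℝ | 1/2 < |u|} ∈ 𝓝 t :=
          (isOpen_lt continuous_const continuous_abs).mem_nhds (by simp only [mem_ofPred_eq]; linarith)
        filter_upwards [ho] with u hu
        rw [χ.zero_of_le_dist (by simpa [χ] using hu.le), zero_mul]
      exact contDiffAt_const.congr_of_eventuallyEq hev
  · intro x hx
    have hp := Real.pi_pos
    have hp4 := Real.pi_lt_four
    have hb : |2 * Real.pi * x| < 1/4 := by
      rw [abs_mul, abs_of_pos (by positivity)]; nlinarith [abs_nonneg x]
    have hs : |Real.sin (2 * Real.pi * x)| ≤ 1/4 := (Real.abs_sin_le_abs).trans hb.le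
    have hb2 := abs_lt.1 hb
    have := Real.pi_gt_three
    simp only
    rw [χ.one_of_mem_closedBall (by simpa [χ] using hs), one_mul, Real.arcsin_sin (by linarith) (by linarith)]
    field_simp

lemma WA.atm (s : ℕ) (k : ℤ × ℤ) (θ : ℝ) : WA s (fun z => KR.atm k θ z) (wt k ^ s) := by
  refine ⟨Unit, fun _ => k, fun _ => θ, fun _ => (1:ℝ), ?_, fun z => ?_⟩
  · simp
  · simp

lemma exists_cut : ∃ (C : ℝ≥0) (sx sy : ℂ → ℝ), WA 3 sx C ∧ WA 3 sy C ∧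
    (∀ z : ℂ, |z.re| < 1/100 → sx z = z.re) ∧ (∀ z : ℂ, |z.im| < 1/100 → sy z = z.im) := by
  obtain ⟨h, hh, hs⟩ := exists_h
  have hN : ContDiff ℝ (⊤ : ℕ∞) (fun t : ℝ => (h t : ℂ)) := Complex.ofRealCLM.contDiff.comp hh
  obtain ⟨C, hC⟩ := comp_WA 3 le_rfl hN (wt (1,0) ^ 3)
  have hw : wt (0,1) = wt (1,0) := by simp [wt]
  have hx := (hC _ (WA.atm 3 (1,0) (-(Real.pi/2)))).clm Complex.reCLM
  have hy := (hC _ (by rw [← hw]; exact WA.atm 3 (0,1) (-(Real.pi/2)))).clm Complex.reCLM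
  refine ⟨_, _, _, hx, hy, fun z hz => ?_, fun z hz => ?_⟩
  · have := hs z.re hz
    simp only [Complex.reCLM_apply, Complex.ofReal_re, KR.atm, ph, ← sub_eq_add_neg, Real.cos_sub_pi_div_two]
    simpa using this
  · have := hs z.im hz
    simp only [Complex.reCLM_apply, Complex.ofReal_re, KR.atm, ph, ← sub_eq_add_neg, Real.cos_sub_pi_div_two]
    simpa using this

section
variable {E : Type} [NormedAddCommGroup E] [NormedSpace ℝ E] [NormedSpace ℂ E] [IsScalarTower ℝ ℂ E]
  [CompleteSpace E]

variable (E) in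
abbrev YY := lp (fun _ : ℤ × ℤ => E) 1

def cc (m : ℤ × ℤ → ℂ) (g : YY E) (k : ℤ × ℤ) : E := (((wt k ^ 3)⁻¹ : ℝ≥0) : ℝ) • (m k • g k)

def TT (m : ℤ × ℤ → ℂ) (g : YY E) (z : ℂ) : E := ∑' k, ex k z • cc m g k

lemma YY.hasSum (g : YY E) : HasSum (fun k => ‖g k‖) ‖g‖ := by
  have := lp.hasSum_norm (p := 1) (by simp) g
  simpa using this

lemma wt_ne (k : ℤ × ℤ) : wt k ≠ 0 := ne_of_gt (lt_of_lt_of_le one_pos (one_le_wt k))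

lemma cc_le {m : ℤ × ℤ → ℂ} (hm : ∀ k, ‖m k‖ ≤ 1) (g : YY E) :
    ∑' k, ((wt k ^ 3 * ‖cc m g k‖₊ : ℝ≥0) : ℝ≥0∞) ≤ ‖g‖₊ := by
  have h := YY.hasSum g
  have h' : HasSum (fun k => ‖g k‖₊) ‖g‖₊ := by
    rw [← NNReal.hasSum_coe]; simpa using h
  rw [← h'.tsum_eq, ENNReal.coe_tsum h'.summable]
  refine ENNReal.tsum_le_tsum fun k => ?_
  norm_cast
  rw [cc, nnnorm_smul, nnnorm_smul]
  have e : ‖(((wt k ^ 3)⁻¹ : ℝ≥0) : ℝ)‖₊ = (wt k ^ 3)⁻¹ := by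
    ext; simp
  rw [e, ← mul_assoc, mul_inv_cancel₀ (pow_ne_zero _ (wt_ne k)), one_mul]
  exact mul_le_of_le_one_left' (by exact_mod_cast hm k)

lemma cc_summable {m : ℤ × ℤ → ℂ} (hm : ∀ k, ‖m k‖ ≤ 1) (g : YY E) : Summable (fun k => ‖cc m g k‖) := by
  have h1 := summable_of_le (cc_le hm g)
  refine summable_norm_iff_nn (NNReal.summable_of_le (fun k => ?_) h1)
  calc ‖cc m g k‖₊ = 1 * ‖cc m g k‖₊ := (one_mul _).symm
      _ ≤ _ := by gcongr; exact one_le_pow₀ (one_le_wt k)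

lemma TT_WA {m : ℤ × ℤ → ℂ} (hm : ∀ k, ‖m k‖ ≤ 1) (g : YY E) : WA 3 (TT m g) (2 * ‖g‖₊) :=
  WA.of_series (cf_series (cc_summable hm g)).2.2.1 (cc_le hm g)

lemma TT_sub {m : ℤ × ℤ → ℂ} (hm : ∀ k, ‖m k‖ ≤ 1) (g g' : YY E) (z : ℂ) : TT m (g - g') z = TT m g z - TT m g' z := by
  have h1 := (cf_series (cc_summable hm g)).2.2.1 z
  have h2 := (cf_series (cc_summable hm g')).2.2.1 z
  have h3 := (h1.sub h2).tsum_eq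
  rw [TT, TT, TT, ← h3]
  congr 1; ext k
  rw [← smul_sub, cc, cc, cc, ← smul_sub, ← smul_sub]; rfl

/-- derivatives of series -/
lemma TT_fderiv {m : ℤ × ℤ → ℂ} (hm : ∀ k, ‖m k‖ ≤ 1) (g : YY E) (z : ℂ) :
    HasSum (fun k => ex k z • ((2 * Real.pi * k.1 * Complex.I : ℂ) • cc m g k)) (fderiv ℝ (TT m g) z 1) ∧
    HasSum (fun k => ex k z • ((2 * Real.pi * k.2 * Complex.I : ℂ) • cc m g k)) (fderiv ℝ (TT m g) z Complex.I) := by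
  have hW := TT_WA hm g
  have hC : ContDiff ℝ 1 (TT m g) := (WA.contDiff 3 hW).1.of_le (by norm_num)
  have hc : Continuous (fderiv ℝ (TT m g)) := hC.continuous_fderiv one_ne_zero
  have hcf := (cf_series (cc_summable hm g)).2.2.2
  have hcf' : ∀ k, cf (TT m g) k = cc m g k := hcf
  have hW1 : WA 2 (fderiv ℝ (TT m g)) (7 * (2 * ‖g‖₊)) := (WA.fderiv (s := 2) hW).2
  have hp := per_fderiv hW.per
  have hs : Summable (fun k => ‖cf (fderiv ℝ (TT m g)) k‖) := by
    have h1 := summable_of_le (hW1.mono (Nat.zero_le 2) le_rfl).cf_le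
    simp only [pow_zero, one_mul] at h1
    exact summable_norm_iff_nn h1
  constructor
  · have := inversion (F := fun z => fderiv ℝ (TT m g) z 1) (by fun_prop)
      ⟨fun z => by simp only [hp.1], fun z => by simp only [hp.2]⟩ (by
        simp only [cf_eval hc]
        exact Summable.of_nonneg_of_le (fun _ => norm_nonneg _) (fun k => by
          simpa using (cf (fderiv ℝ (TT m g)) k).le_opNorm 1) hs) z
    simpa only [cf_fderiv_one hC hW.per, hcf'] using this
  · have := inversion (F := fun z => fderiv ℝ (TT m g) z Complex.I) (by fun_prop)
      ⟨fun z => by simp only [hp.1], fun z => by simp only [hp.2]⟩ (by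
        simp only [cf_eval hc]
        exact Summable.of_nonneg_of_le (fun _ => norm_nonneg _) (fun k => by
          simpa using (cf (fderiv ℝ (TT m g)) k).le_opNorm Complex.I) hs) z
    simpa only [cf_fderiv_I hC hW.per, hcf'] using this

def kc (k : ℤ × ℤ) : ℂ := k.1 + k.2 * Complex.I
def mP (k : ℤ × ℤ) : ℂ := (2 * Real.pi * kc k)⁻¹
def mQ (k : ℤ × ℤ) : ℂ := k.1 * Complex.I / kc k
def m0 (k : ℤ × ℤ) : ℂ := if k = 0 then 1 else 0

lemma kc_ne {k : ℤ × ℤ} (hk : k ≠ 0) : kc k ≠ 0 := by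
  intro h
  apply hk
  have h1 := congrArg Complex.re h
  have h2 := congrArg Complex.im h
  simp [kc] at h1 h2
  exact Prod.ext h1 h2

lemma kc_ge (k : ℤ × ℤ) : ‖(k.1 : ℂ)‖ ≤ ‖kc k‖ := by
  have := Complex.abs_re_le_norm (kc k)
  simpa [kc] using this

lemma kc_ge' (k : ℤ × ℤ) : ‖(k.2 : ℂ)‖ ≤ ‖kc k‖ := by
  have := Complex.abs_im_le_norm (kc k)
  simpa [kc] using this

lemma kc_ge_one {k : ℤ × ℤ} (hk : k ≠ 0) : 1 ≤ ‖kc k‖ := by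
  by_cases h : k.1 = 0
  · have h2 : k.2 ≠ 0 := fun h2 => hk (Prod.ext h h2)
    refine le_trans ?_ (kc_ge' k)
    rw [Complex.norm_intCast]; exact_mod_cast Int.one_le_abs h2
  · refine le_trans ?_ (kc_ge k)
    rw [Complex.norm_intCast]; exact_mod_cast Int.one_le_abs h

lemma mP_le (k : ℤ × ℤ) : ‖mP k‖ ≤ 1 := by
  by_cases hk : k = 0
  · simp [mP, kc, hk]
  · rw [mP, norm_inv]
    apply inv_le_one_of_one_le₀
    rw [norm_mul]
    have := kc_ge_one hk
    have e2 : 1 ≤ ‖(2 * Real.pi : ℂ)‖ := by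
      rw [norm_mul]; simp
      rw [abs_of_pos Real.pi_pos]; linarith [Real.pi_gt_three]
    nlinarith

lemma mQ_le (k : ℤ × ℤ) : ‖mQ k‖ ≤ 1 := by
  rw [mQ, norm_div, norm_mul, Complex.norm_I, mul_one]
  exact div_le_one_of_le₀ (kc_ge k) (norm_nonneg _)

lemma m0_le (k : ℤ × ℤ) : ‖m0 k‖ ≤ 1 := by
  unfold m0; split_ifs <;> simp

lemma TT_P_one (g : YY E) (z : ℂ) : fderiv ℝ (TT mP g) z 1 = TT mQ g z := by
  have h := (TT_fderiv mP_le g z).1.tsum_eq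
  rw [← h, TT]
  congr 1; ext k
  congr 1
  rw [cc, cc, smul_comm, smul_smul]
  congr 2
  rw [mP, mQ]
  by_cases hk : k = 0
  · simp [hk, kc]
  · have := kc_ne hk
    have hp : (Real.pi : ℂ) ≠ 0 := by exact_mod_cast Real.pi_ne_zero
    field_simp

lemma TT_0 (g : YY E) (z : ℂ) : TT m0 g z = TT m0 g 0 := by
  rw [TT, TT]; congr 1; ext k
  by_cases hk : k = 0
  · simp [hk, ex, ph]
  · simp [cc, m0, hk]

lemma TT_P_I (g : YY E) (z : ℂ) :
    fderiv ℝ (TT mP g) z Complex.I = Complex.I • TT mQ g z + (TT 1 g z - TT m0 g z) := by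
  have h := (TT_fderiv mP_le g z).2.tsum_eq
  have h1 := ((cf_series (cc_summable mQ_le g)).2.2.1 z).const_smul Complex.I
  have h2 := (cf_series (cc_summable (m := 1) (by simp) g)).2.2.1 z
  have h3 := (cf_series (cc_summable m0_le g)).2.2.1 z
  have := (h1.add (h2.sub h3)).tsum_eq
  rw [← h, TT, TT, TT, ← this]
  congr 1; ext k
  rw [smul_comm Complex.I, ← smul_sub, ← smul_add]
  congr 1
  rw [cc, cc, cc, cc, smul_comm _ (_ : ℝ), smul_comm Complex.I (_ : ℝ), ← smul_sub, ← smul_add]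
  congr 1
  rw [smul_smul, smul_smul, ← sub_smul, ← add_smul]
  congr 1
  rw [mP, mQ, m0, Pi.one_apply]
  by_cases hk : k = 0
  · simp [hk, kc]
  · have := kc_ne hk
    have hp : (Real.pi : ℂ) ≠ 0 := by exact_mod_cast Real.pi_ne_zero
    rw [if_neg hk]
    field_simp
    rw [kc]
    linear_combination (-(k.1 : ℂ)) * Complex.I_sq

end
end KR

namespace KR
open scoped NNReal BoundedContinuousFunction
section
variable {E : Type} [NormedAddCommGroup E] [NormedSpace ℝ E] [NormedSpace ℂ E] [IsScalarTower ℝ ℂ E]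
  [CompleteSpace E]

lemma nn_norm_le_of_WA {F : ℂ → E} {C : ℝ≥0} (h : WA 3 F C) (z : ℂ) : ‖F z‖₊ ≤ C := h.norm_le z

/-- scalar cutoff times constant -/
lemma WA.smul_const {s : ℂ → ℝ} {C : ℝ≥0} (h : WA 3 s C) (c : E) : WA 3 (fun z => s z • c) (C * ‖c‖₊) := by
  have := h.clm (ContinuousLinearMap.smulRight (1 : ℝ →L[ℝ] ℝ) c)
  refine (this.mono le_rfl ?_ : WA 3 _ (C * ‖c‖₊))
  rw [mul_comm]
  gcongr
  rw [← NNReal.coe_le_coe]; simp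

def WW (sx sy : ℂ → ℝ) (v : E) (g : YY E) (z : ℂ) : E :=
  sx z • (v - TT mQ g 0) + sy z • (Complex.I • (v - TT mQ g 0)) + sy z • TT m0 g 0 + (TT mP g z - TT mP g 0)

def DD (v : E) (g : YY E) (z : ℂ) : E := v + (TT mQ g z - TT mQ g 0)

lemma WW_WA {sx sy : ℂ → ℝ} {C : ℝ≥0} (hx : WA 3 sx C) (hy : WA 3 sy C) (v : E) (g : YY E) :
    WA 3 (WW sx sy v g) ((2 * C) * ‖v‖₊ + (6 * C + 4) * ‖g‖₊) := by
  have b1 := nn_norm_le_of_WA (TT_WA mQ_le g) 0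
  have b2 := nn_norm_le_of_WA (TT_WA m0_le g) 0
  have b3 := nn_norm_le_of_WA (TT_WA mP_le g) 0
  have b4 : ‖v - TT mQ g 0‖₊ ≤ ‖v‖₊ + 2 * ‖g‖₊ := (nnnorm_sub_le _ _).trans (by gcongr)
  have h := (((hx.smul_const (v - TT mQ g 0)).add (hy.smul_const (Complex.I • (v - TT mQ g 0)))).add
    (hy.smul_const (TT m0 g 0))).add ((TT_WA mP_le g).sub (WA.const 3 (TT mP g 0)))
  refine h.mono le_rfl ?_
  rw [nnnorm_smul, Complex.nnnorm_I, one_mul]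
  calc _ ≤ C * (‖v‖₊ + 2 * ‖g‖₊) + C * (‖v‖₊ + 2 * ‖g‖₊) + C * (2 * ‖g‖₊) + (2 * ‖g‖₊ + 2 * ‖g‖₊) := by gcongr
    _ = _ := by ring

lemma DD_WA (v : E) (g : YY E) : WA 3 (DD v g) (‖v‖₊ + 4 * ‖g‖₊) := by
  have b1 := nn_norm_le_of_WA (TT_WA mQ_le g) 0
  have h := (WA.const 3 v).add ((TT_WA mQ_le g).sub (WA.const 3 (TT mQ g 0)))
  refine h.mono le_rfl ?_
  calc _ ≤ ‖v‖₊ + (2 * ‖g‖₊ + 2 * ‖g‖₊) := by gcongr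
    _ = _ := by ring

lemma WW_sub (sx sy : ℂ → ℝ) (v : E) (g g' : YY E) (z : ℂ) :
    WW sx sy v g z - WW sx sy v g' z = WW sx sy 0 (g - g') z := by
  simp only [WW, TT_sub mQ_le, TT_sub m0_le, TT_sub mP_le, smul_sub, smul_zero]
  abel

lemma DD_sub (v : E) (g g' : YY E) (z : ℂ) :
    DD v g z - DD v g' z = DD 0 (g - g') z := by
  simp only [DD, TT_sub mQ_le]
  abel

lemma smul_coe_eq (r : ℝ) (x : E) : (r : ℂ) • x = r • x := algebraMap_smul ℂ r x

lemma WW_fderiv {sx sy : ℂ → ℝ} (hx : ∀ z : ℂ, |z.re| < 1/100 → sx z = z.re)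
    (hy : ∀ z : ℂ, |z.im| < 1/100 → sy z = z.im) (v : E) (g : YY E) (z : ℂ) (hz : ‖z‖ < 1/100) :
    DifferentiableAt ℝ (WW sx sy v g) z ∧ fderiv ℝ (WW sx sy v g) z 1 = DD v g z ∧
    fderiv ℝ (WW sx sy v g) z Complex.I = Complex.I • DD v g z + TT 1 g z := by
  set c := v - TT mQ g 0 with hc
  have hP : DifferentiableAt ℝ (TT mP g) z := (WA.contDiff 3 (TT_WA mP_le g)).1.differentiable (by norm_num) z
  have h1 : HasFDerivAt (fun z : ℂ => Complex.reCLM z • c + Complex.imCLM z • (Complex.I • c) + Complex.imCLM z • TT m0 g 0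
      + (TT mP g z - TT mP g 0))
      (Complex.reCLM.smulRight c + Complex.imCLM.smulRight (Complex.I • c) + Complex.imCLM.smulRight (TT m0 g 0)
        + fderiv ℝ (TT mP g) z) z := by
    refine (((Complex.reCLM.smulRight c).hasFDerivAt.add (Complex.imCLM.smulRight (Complex.I • c)).hasFDerivAt).add
      (Complex.imCLM.smulRight (TT m0 g 0)).hasFDerivAt).add (hP.hasFDerivAt.sub_const _)
  have hev : WW sx sy v g =ᶠ[𝓝 z] fun z : ℂ => Complex.reCLM z • c + Complex.imCLM z • (Complex.I • c) + Complex.imCLM z • TT m0 g 0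
      + (TT mP g z - TT mP g 0) := by
    filter_upwards [(isOpen_lt continuous_norm continuous_const).mem_nhds hz] with w hw
    rw [WW, hx w ((Complex.abs_re_le_norm w).trans_lt hw), hy w ((Complex.abs_im_le_norm w).trans_lt hw)]
    rfl
  have h2 := h1.congr_of_eventuallyEq hev
  refine ⟨h2.differentiableAt, ?_, ?_⟩
  · rw [h2.fderiv]
    simp [TT_P_one, DD, hc]
    abel
  · rw [h2.fderiv]
    simp [TT_P_I, DD, hc, TT_0 g z, smul_sub]
    abel

lemma WW_zero {sx sy : ℂ → ℝ} (hx : ∀ z : ℂ, |z.re| < 1/100 → sx z = z.re)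
    (hy : ∀ z : ℂ, |z.im| < 1/100 → sy z = z.im) (v : E) (g : YY E) : WW sx sy v g 0 = 0 := by
  simp [WW, hx 0 (by simp), hy 0 (by simp)]

lemma DD_zero (v : E) (g : YY E) : DD v g 0 = v := by simp [DD]

open Classical in
def toY (H : ℂ → E) : YY E :=
  if h : Memℓp (fun k : ℤ × ℤ => ((wt k ^ 3 : ℝ≥0) : ℝ) • cf H k) 1 then ⟨_, h⟩ else 0

lemma WA.summ {H : ℂ → E} {C : ℝ≥0} (h : WA 3 H C) :
    Summable (fun k : ℤ × ℤ => ‖((wt k ^ 3 : ℝ≥0) : ℝ) • cf H k‖) := by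
  have h1 := summable_of_le h.cf_le
  refine summable_norm_iff_nn ?_
  convert h1 using 2 with k
  rw [nnnorm_smul]; congr 1; ext; simp

lemma toY_apply {H : ℂ → E} {C : ℝ≥0} (h : WA 3 H C) (k : ℤ × ℤ) : toY H k = ((wt k ^ 3 : ℝ≥0) : ℝ) • cf H k := by
  have h2 : Memℓp (fun k : ℤ × ℤ => ((wt k ^ 3 : ℝ≥0) : ℝ) • cf H k) 1 := by
    rw [memℓp_gen_iff (by simp)]
    simpa using h.summ
  rw [toY, dif_pos h2]

lemma toY_norm_sub {H H' : ℂ → E} {C C' D : ℝ≥0} (h : WA 3 H C) (h' : WA 3 H' C') (hd : WA 3 (fun z => H z - H' z) D) :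
    ‖toY H - toY H'‖₊ ≤ D := by
  have hs := YY.hasSum (toY H - toY H')
  have hcont : ∀ {H : ℂ → E} {C : ℝ≥0} (h : WA 3 H C), Continuous H := fun h => (WA.contDiff 3 h).1.continuous
  have e : (fun k => ‖(toY H - toY H') k‖) = fun k => ((wt k ^ 3 * ‖cf (fun z => H z - H' z) k‖₊ : ℝ≥0) : ℝ) := by
    ext k
    rw [lp.coeFn_sub, Pi.sub_apply, toY_apply h, toY_apply h', ← smul_sub, ← cf_sub (hcont h) (hcont h'), norm_smul]
    simp
  rw [e] at hs
  have h1 := hd.cf_le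
  have h2 : HasSum (fun k => wt k ^ 3 * ‖cf (fun z => H z - H' z) k‖₊) ‖toY H - toY H'‖₊ := by
    rw [← NNReal.hasSum_coe]; exact hs
  rw [← ENNReal.coe_le_coe, ← h2.tsum_eq, ENNReal.coe_tsum h2.summable]
  exact h1

lemma toY_norm {H : ℂ → E} {C : ℝ≥0} (h : WA 3 H C) : ‖toY H‖₊ ≤ C := by
  have h0 : WA 3 (fun _ : ℂ => (0:E)) 0 := by simpa using WA.const 3 (0:E)
  have e : toY (fun _ : ℂ => (0:E)) = 0 := by
    ext k; rw [toY_apply h0]; simp [cf]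
  have := toY_norm_sub h h0 (by simpa using h)
  simpa [e] using this

lemma TT_toY {H : ℂ → E} {C : ℝ≥0} (h : WA 3 H C) (z : ℂ) : TT 1 (toY H) z = H z := by
  have hcont : Continuous H := (WA.contDiff 3 h).1.continuous
  have h1 := summable_of_le (h.mono (Nat.zero_le 3) le_rfl).cf_le
  simp only [pow_zero, one_mul] at h1
  rw [← (inversion hcont h.per (summable_norm_iff_nn h1) z).tsum_eq, TT]
  congr 1; ext k
  congr 1
  rw [cc, toY_apply h, Pi.one_apply, one_smul, smul_smul, ← NNReal.coe_mul, inv_mul_cancel₀ (pow_ne_zero _ (wt_ne k))]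
  simp

end
end KR

namespace KR
open scoped NNReal BoundedContinuousFunction
section
variable {E : Type} [NormedAddCommGroup E] [NormedSpace ℝ E] [NormedSpace ℂ E] [IsScalarTower ℝ ℂ E]
  [CompleteSpace E]

lemma WA.app {F : ℂ → (E →L[ℝ] E)} {G : ℂ → E} {C D : ℝ≥0} (h : WA 3 F C) (h' : WA 3 G D) :
    WA 3 (fun z => F z (G z)) (C * D) := by
  have h2 := h.bilin h' (ContinuousLinearMap.id ℝ (E →L[ℝ] E))
  refine (h2.mono le_rfl ?_ : WA 3 _ (C * D))
  have : ‖ContinuousLinearMap.id ℝ (E →L[ℝ] E)‖₊ ≤ 1 := ContinuousLinearMap.norm_id_le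
  calc _ ≤ 1 * C * D := by gcongr
    _ = _ := by ring

lemma consts (CL Cw : ℝ≥0) (ρ : ℝ) (hρ : 0 < ρ) : ∃ ε : ℝ≥0, 0 < ε ∧ ε ≤ 1 ∧ (ε * Cw : ℝ) < ρ / 2 ∧
    ∃ a : ℝ≥0, 0 < a ∧ (a + CL * (ε * Cw)) * Cw ≤ 1 ∧
      (CL * (ε * Cw)) * Cw + (a + CL * (ε * Cw)) * Cw ≤ 1/2 := by
  let m : ℝ≥0 := min (Real.toNNReal ρ) 1
  have hm : 0 < m := lt_min (by simpa using hρ) one_pos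
  have hm1 : m ≤ 1 := min_le_right _ _
  have hmρ : (m : ℝ) ≤ ρ := by
    have : m ≤ Real.toNNReal ρ := min_le_left _ _
    have := NNReal.coe_le_coe.2 this
    rwa [Real.coe_toNNReal _ hρ.le] at this
  refine ⟨m / (8 * (CL + 1) * (Cw + 1) ^ 2), by positivity, ?_, ?_, 1 / (8 * (Cw + 1)), by positivity, ?_⟩
  · refine div_le_one_of_le₀ (hm1.trans ?_) (by positivity)
    rw [← NNReal.coe_le_coe]; push_cast
    have := CL.coe_nonneg; have := Cw.coe_nonneg
    nlinarith [mul_nonneg CL.coe_nonneg Cw.coe_nonneg, mul_nonneg CL.coe_nonneg (sq_nonneg (Cw:ℝ))]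
  · push_cast
    have hL := CL.coe_nonneg; have hW := Cw.coe_nonneg
    have hm' : (0:ℝ) < m := hm
    rw [div_mul_eq_mul_div, div_lt_iff₀ (by positivity)]
    have : (m:ℝ) * Cw ≤ ρ * Cw := by gcongr
    have h2 : (Cw : ℝ) < (1/2) * (8 * (CL + 1) * (Cw + 1) ^ 2) := by
      nlinarith [mul_nonneg hL hW, mul_nonneg hL (sq_nonneg (Cw:ℝ))]
    nlinarith
  · have key : (CL * (m / (8 * (CL + 1) * (Cw + 1) ^ 2) * Cw)) * Cw ≤ 1/8 := by
      rw [← NNReal.coe_le_coe]; push_cast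
      have hL := CL.coe_nonneg; have hW := Cw.coe_nonneg
      have hm' : (m:ℝ) ≤ 1 := hm1
      have e : (CL * (m / (8 * (CL + 1) * (Cw + 1) ^ 2) * Cw)) * Cw = (m * (CL * (Cw * Cw)) : ℝ) / (8 * (CL + 1) * (Cw + 1) ^ 2) := by ring
      rw [e, div_le_iff₀ (by positivity)]
      have : (m * (CL * (Cw * Cw)) : ℝ) ≤ 1 * (CL * (Cw * Cw)) := by gcongr
      nlinarith [mul_nonneg hL hW]
    have key2 : 1 / (8 * (Cw + 1)) * Cw ≤ 1/8 := by
      rw [← NNReal.coe_le_coe]; push_cast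
      have hW := Cw.coe_nonneg
      rw [div_mul_eq_mul_div, div_le_iff₀ (by positivity)]
      linarith
    have k3 : (1 / (8 * (Cw + 1)) + CL * (m / (8 * (CL + 1) * (Cw + 1) ^ 2) * Cw)) * Cw ≤ 1/8 + 1/8 := by
      rw [add_mul]; exact add_le_add key2 key
    refine ⟨k3.trans ?_, (add_le_add key k3).trans ?_⟩
    · rw [← NNReal.coe_le_coe]; push_cast; norm_num
    · rw [← NNReal.coe_le_coe]; push_cast; norm_num

lemma core [ProperSpace E] {A : E → (E →L[ℝ] E)} (hA : ContDiff ℝ (⊤ : ℕ∞) A) (q0 : E) (hA0 : A q0 = 0)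
    {ρ : ℝ} (hρ : 0 < ρ) : ∃ r : ℝ, 0 < r ∧ ∃ η : ℝ, 0 < η ∧ ∀ q ∈ ball q0 η, ∀ v : E, ‖v‖ ≤ 1 →
    ∃ f : ℂ → E, f 0 = q ∧ fderiv ℝ f 0 1 = r • v ∧ ∀ z ∈ ball (0:ℂ) 1, f z ∈ ball q0 ρ ∧ DifferentiableAt ℝ f z ∧
      fderiv ℝ f z Complex.I = Complex.I • fderiv ℝ f z 1 + A (f z) (fderiv ℝ f z 1) := by
  obtain ⟨C, sx, sy, hx, hy, hx', hy'⟩ := exists_cut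
  set Cw : ℝ≥0 := 8 * C + 9 with hCw
  obtain ⟨CL, hCL⟩ := lip_WA hA (‖q0‖₊ + 1 + Cw)
  obtain ⟨ε, hε0, hε1, hερ, a, ha0, hk1, hk2⟩ := consts CL Cw ρ hρ
  have hAc : {q | ‖A q‖ < a} ∈ 𝓝 q0 := by
    refine (isOpen_lt (hA.continuous.norm) continuous_const).mem_nhds ?_
    simpa [hA0] using ha0
  obtain ⟨η1, hη1, hη1'⟩ := Metric.mem_nhds_iff.1 hAc
  refine ⟨ε * (1/100), by positivity, min η1 (min 1 (ρ/2)), by positivity, fun q hq v hv => ?_⟩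
  rw [mem_ball] at hq
  have hqa : ‖A q‖₊ ≤ a := (hη1' (mem_ball.2 (hq.trans_le (min_le_left _ _)))).le
  have hq1 : dist q q0 < 1 := hq.trans_le ((min_le_right _ _).trans (min_le_left _ _))
  have hqρ : dist q q0 < ρ / 2 := hq.trans_le ((min_le_right _ _).trans (min_le_right _ _))
  have hqn : ‖q‖₊ ≤ ‖q0‖₊ + 1 := by
    rw [← NNReal.coe_le_coe]; push_cast
    have := norm_le_norm_add_norm_sub' q q0
    rw [dist_eq_norm] at hq1
    linarith
  have hv' : ‖v‖₊ ≤ 1 := hv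
  have hWb : ∀ g : YY E, ‖g‖₊ ≤ 1 → WA 3 (WW sx sy v g) Cw := fun g hg =>
    (WW_WA hx hy v g).mono le_rfl (by
      calc _ ≤ (2 * C) * 1 + (6 * C + 4) * 1 := by gcongr
        _ ≤ (2 * C) * 1 + (6 * C + 4) * 1 + 5 := le_self_add
        _ = _ := by rw [hCw]; ring)
  have hDb : ∀ g : YY E, ‖g‖₊ ≤ 1 → WA 3 (DD v g) Cw := fun g hg =>
    (DD_WA v g).mono le_rfl (by
      calc _ ≤ 1 + 4 * 1 := by gcongr
        _ ≤ 1 + 4 * 1 + (8 * C + 4) := le_self_add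
        _ = _ := by rw [hCw]; ring)
  have hWd : ∀ g g' : YY E, WA 3 (fun z => WW sx sy v g z - WW sx sy v g' z) (Cw * ‖g - g'‖₊) := fun g g' => by
    simp only [WW_sub]
    refine (WW_WA hx hy 0 (g - g')).mono le_rfl ?_
    rw [nnnorm_zero, mul_zero, zero_add]
    gcongr
    calc 6 * C + 4 ≤ 6 * C + 4 + (2 * C + 5) := le_self_add
      _ = _ := by rw [hCw]; ring
  have hDd : ∀ g g' : YY E, WA 3 (fun z => DD v g z - DD v g' z) (Cw * ‖g - g'‖₊) := fun g g' => by
    simp only [DD_sub]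
    refine (DD_WA 0 (g - g')).mono le_rfl ?_
    rw [nnnorm_zero, zero_add]
    gcongr
    calc 4 ≤ 4 + (8 * C + 5) := le_self_add
      _ = _ := by rw [hCw]; ring
  let U : YY E → ℂ → E := fun g z => q + (ε : ℝ) • WW sx sy v g z
  have nε : ‖(ε : ℝ)‖₊ = ε := by ext; simp
  have hUd : ∀ g g' : YY E, WA 3 (fun z => U g z - U g' z) (ε * (Cw * ‖g - g'‖₊)) := fun g g' => by
    have := (hWd g g').smul ε
    rw [nε] at this
    simpa only [U, add_sub_add_left_eq_sub, ← smul_sub] using this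
  have hUq : ∀ g : YY E, ‖g‖₊ ≤ 1 → WA 3 (fun z => U g z - q) (ε * Cw) := fun g hg => by
    have := (hWb g hg).smul ε
    rw [nε] at this
    simpa only [U, add_sub_cancel_left] using this
  have hqR : WA 3 (fun _ : ℂ => q) (‖q0‖₊ + 1 + Cw) := (WA.const 3 q).mono le_rfl (hqn.trans le_self_add)
  have hUR : ∀ g : YY E, ‖g‖₊ ≤ 1 → WA 3 (U g) (‖q0‖₊ + 1 + Cw) := fun g hg => by
    have := (hUq g hg).add (WA.const 3 q)
    simp only [sub_add_cancel] at this
    refine this.mono le_rfl ?_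
    rw [add_comm]
    gcongr
    exact mul_le_of_le_one_left' hε1
  have hAU : ∀ g : YY E, ‖g‖₊ ≤ 1 → WA 3 (fun z => A (U g z)) (a + CL * (ε * Cw)) := fun g hg => by
    have := (hCL _ _ _ (hUR g hg) hqR (hUq g hg)).add (WA.const 3 (A q))
    simp only [sub_add_cancel] at this
    refine this.mono le_rfl ?_
    rw [add_comm]
    gcongr
  let H : YY E → ℂ → E := fun g z => A (U g z) (DD v g z)
  have hH : ∀ g : YY E, ‖g‖₊ ≤ 1 → WA 3 (H g) 1 := fun g hg =>
    ((hAU g hg).app (hDb g hg)).mono le_rfl hk1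
  have hHd : ∀ g g' : YY E, ‖g‖₊ ≤ 1 → ‖g'‖₊ ≤ 1 → WA 3 (fun z => H g z - H g' z) (1/2 * ‖g - g'‖₊) := fun g g' hg hg' => by
    have h1 := (hCL _ _ _ (hUR g hg) (hUR g' hg') (hUd g g')).app (hDb g hg)
    have h2 := (hAU g' hg').app (hDd g g')
    have h3 := h1.add h2
    have e : (fun z => H g z - H g' z) = fun z => (A (U g z) - A (U g' z)) (DD v g z) + A (U g' z) (DD v g z - DD v g' z) := by
      ext1 z; simp only [H, ContinuousLinearMap.sub_apply, map_sub]; abel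
    rw [e]
    refine h3.mono le_rfl ?_
    calc _ = ((CL * (ε * Cw)) * Cw + (a + CL * (ε * Cw)) * Cw) * ‖g - g'‖₊ := by ring
      _ ≤ _ := by gcongr
  let Φ : YY E → YY E := fun g => toY (H g)
  have hmaps : MapsTo Φ (closedBall 0 1) (closedBall 0 1) := by
    intro g hg
    have hg' : ‖g‖₊ ≤ 1 := (mem_closedBall_zero_iff.1 hg : ‖g‖ ≤ 1)
    have := toY_norm (hH g hg')
    exact mem_closedBall_zero_iff.2 this
  have hcontr : ContractingWith (1/2) (hmaps.restrict Φ (closedBall 0 1) (closedBall 0 1)) := by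
    refine ⟨?_, ?_⟩
    · rw [← NNReal.coe_lt_coe]; push_cast; norm_num
    · refine LipschitzWith.of_dist_le_mul fun g g' => ?_
      have hg : ‖(g : YY E)‖₊ ≤ 1 := (mem_closedBall_zero_iff.1 g.2 : ‖(g : YY E)‖ ≤ 1)
      have hg' : ‖(g' : YY E)‖₊ ≤ 1 := (mem_closedBall_zero_iff.1 g'.2 : ‖(g' : YY E)‖ ≤ 1)
      have := toY_norm_sub (hH g hg) (hH g' hg') (hHd g g' hg hg')
      rw [Subtype.dist_eq, Subtype.dist_eq, dist_eq_norm, dist_eq_norm]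
      exact this
  obtain ⟨g, hg, hfix, -⟩ := hcontr.exists_fixedPoint' (isClosed_closedBall.isComplete) hmaps
    (x := 0) (by simp) (edist_ne_top _ _)
  have hg1 : ‖g‖₊ ≤ 1 := (mem_closedBall_zero_iff.1 hg : ‖g‖ ≤ 1)
  have hgH : ∀ z, TT 1 g z = H g z := fun z => by
    have := TT_toY (hH g hg1) z
    rwa [show toY (H g) = g from hfix] at this
  have hfd : ∀ z ∈ ball (0:ℂ) 1, HasFDerivAt (fun z => U g ((1/100 : ℝ) • z))
      (((ε : ℝ) * (1/100)) • fderiv ℝ (WW sx sy v g) ((1/100 : ℝ) • z)) z ∧ 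
      fderiv ℝ (WW sx sy v g) ((1/100 : ℝ) • z) 1 = DD v g ((1/100 : ℝ) • z) ∧
      fderiv ℝ (WW sx sy v g) ((1/100 : ℝ) • z) Complex.I = Complex.I • DD v g ((1/100 : ℝ) • z) + TT 1 g ((1/100 : ℝ) • z) := by
    intro z hz
    have hz' : ‖(1/100 : ℝ) • z‖ < 1/100 := by
      rw [norm_smul]; simp at hz ⊢; linarith
    obtain ⟨d1, d2, d3⟩ := WW_fderiv hx' hy' v g _ hz'
    refine ⟨?_, d2, d3⟩
    have h0 : HasFDerivAt (fun z : ℂ => (1/100 : ℝ) • z) ((1/100 : ℝ) • ContinuousLinearMap.id ℝ ℂ) z :=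
      (hasFDerivAt_id z).const_smul (1/100 : ℝ)
    have h1 := ((d1.hasFDerivAt.comp z h0).const_smul (ε : ℝ)).const_add q
    have e : ((ε : ℝ) * (1/100)) • fderiv ℝ (WW sx sy v g) ((1/100 : ℝ) • z) = (ε : ℝ) • (fderiv ℝ (WW sx sy v g) ((1/100 : ℝ) • z)).comp ((1/100 : ℝ) • ContinuousLinearMap.id ℝ ℂ) := by
      ext ξ
      simp [mul_smul]
    rw [e]
    exact h1
  refine ⟨fun z => U g ((1/100 : ℝ) • z), ?_, ?_, fun z hz => ⟨?_, (hfd z hz).1.differentiableAt, ?_⟩⟩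
  · simp [U, WW_zero hx' hy']
  · obtain ⟨d1, d2, d3⟩ := hfd 0 (by simp)
    rw [d1.fderiv, ContinuousLinearMap.smul_apply, d2, smul_zero, DD_zero]
  · rw [mem_ball]
    have h1 : dist (U g ((1/100 : ℝ) • z)) q ≤ ε * Cw := by
      rw [dist_eq_norm]
      exact_mod_cast (hUq g hg1).norm_le ((1/100 : ℝ) • z)
    have := dist_triangle (U g ((1/100 : ℝ) • z)) q q0
    linarith
  · obtain ⟨d1, d2, d3⟩ := hfd z hz
    rw [d1.fderiv, ContinuousLinearMap.smul_apply, ContinuousLinearMap.smul_apply, d2, d3, hgH, smul_add, map_smul,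
      smul_comm Complex.I]

end
end KR

namespace KR
open scoped NNReal BoundedContinuousFunction

theorem lin_iso {V W : Type} [AddCommGroup V] [Module ℝ V] [FiniteDimensional ℝ V]
    [AddCommGroup W] [Module ℝ W] [Module ℂ W] [IsScalarTower ℝ ℂ W] [FiniteDimensional ℂ W]
    (hd : Module.finrank ℝ V = 2 * Module.finrank ℂ W) (j : V →ₗ[ℝ] V) (hj : ∀ x, j (j x) = -x) :
    ∃ P : V ≃ₗ[ℝ] W, ∀ x, P (j x) = Complex.I • P x := by
  have hj' : (j : Module.End ℝ V) * j = -1 := by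
    ext x; simp [hj]
  let φ : ℂ →ₐ[ℝ] Module.End ℝ V := Complex.lift ⟨j, hj'⟩
  let _ : Module ℂ V := Module.compHom V φ.toRingHom
  have hs : ∀ (c : ℂ) (x : V), c • x = φ c x := fun c x => rfl
  have : IsScalarTower ℝ ℂ V := ⟨fun a c x => by
    rw [hs, hs, map_smul]; rfl⟩
  have hI : ∀ x : V, Complex.I • x = j x := fun x => by
    rw [hs]; simp [φ]
  have : FiniteDimensional ℂ V := FiniteDimensional.right ℝ ℂ V
  have h2 : Module.finrank ℂ V = Module.finrank ℂ W := by
    have := Module.finrank_mul_finrank ℝ ℂ V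
    rw [Complex.finrank_real_complex] at this
    omega
  let P := LinearEquiv.ofFinrankEq V W h2
  refine ⟨P.restrictScalars ℝ, fun x => ?_⟩
  rw [← hI]
  exact P.map_smul Complex.I x

theorem local_discs (n : ℕ) (Ω : Set (Cn n)) (hΩ : IsOpen Ω)
    (J : Cn n → (Cn n →L[ℝ] Cn n)) (hJ : IsAlmostComplexOn n Ω J) (p0 : Cn n) (hp0 : p0 ∈ Ω) :
    ∃ r : ℝ, 0 < r ∧ ∃ U ∈ 𝓝 p0, ∀ p ∈ U, ∀ v : Cn n, ‖v‖ = 1 →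
      ∃ f : ℂ → Cn n, IsJHolomorphicOn n Ω J 1 f ∧ f 0 = p ∧ fderiv ℝ f 0 1 = r • v := by
  obtain ⟨hJs, hJJ⟩ := hJ
  have hJJ' : ∀ x ∈ Ω, ∀ y, J x (J x y) = -y := fun x hx y => by
    have := congrArg (fun T : Cn n →L[ℝ] Cn n => T y) (hJJ x hx)
    simpa using this
  obtain ⟨P', hP'⟩ := lin_iso (V := Cn n) (W := Cn n) (finrank_real_of_complex _) (J p0).toLinearMap
    (fun x => hJJ' p0 hp0 x)
  let P : Cn n ≃L[ℝ] Cn n := P'.toContinuousLinearEquiv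
  have hP : ∀ x, P (J p0 x) = Complex.I • P x := hP'
  let q0 := P p0
  have hop : IsOpen (P.symm ⁻¹' Ω) := hΩ.preimage P.symm.continuous
  have hq0 : q0 ∈ P.symm ⁻¹' Ω := by simpa [q0] using hp0
  obtain ⟨δ, hδ, hball⟩ := Metric.isOpen_iff.1 hop q0 hq0
  let χ : ContDiffBump q0 := ⟨δ/4, δ/2, by linarith, by linarith⟩
  let mI : Cn n →L[ℝ] Cn n := (Complex.I • ContinuousLinearMap.id ℂ (Cn n)).restrictScalars ℝ
  have hmI : ∀ x, mI x = Complex.I • x := fun x => rfl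
  let B : Cn n → (Cn n →L[ℝ] Cn n) := fun q =>
    ((P : Cn n →L[ℝ] Cn n).comp ((J (P.symm q)).comp (P.symm : Cn n →L[ℝ] Cn n))) - mI
  have hB : ContDiffOn ℝ (⊤ : ℕ∞) B (P.symm ⁻¹' Ω) := by
    have h1 : ContDiffOn ℝ (⊤ : ℕ∞) (fun q => J (P.symm q)) (P.symm ⁻¹' Ω) :=
      hJs.comp P.symm.contDiff.contDiffOn (fun _ h => h)
    exact ((contDiffOn_const.clm_comp (h1.clm_comp contDiffOn_const))).sub contDiffOn_const
  let A : Cn n → (Cn n →L[ℝ] Cn n) := fun q => χ q • B q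
  have hA : ContDiff ℝ (⊤ : ℕ∞) A := by
    rw [contDiff_iff_contDiffAt]
    intro q
    by_cases hq : q ∈ P.symm ⁻¹' Ω
    · exact χ.contDiff.contDiffAt.smul (hB.contDiffAt (hop.mem_nhds hq))
    · have hq' : q ∉ tsupport χ := fun h => hq (hball (by
        rw [χ.tsupport_eq] at h
        exact closedBall_subset_ball (by show δ/2 < δ; linarith) h))
      have : A =ᶠ[𝓝 q] fun _ => 0 := by
        filter_upwards [(isClosed_tsupport χ).isOpen_compl.mem_nhds hq'] with x hx
        have : χ x = 0 := image_eq_zero_of_notMem_tsupport hx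
        show χ x • B x = 0
        rw [this]
        exact zero_smul ℝ (B x)
      exact contDiffAt_const.congr_of_eventuallyEq this
  have hA0 : A q0 = 0 := by
    have : B q0 = 0 := by
      ext1 x
      have h := hP (P.symm x)
      simp [B, q0, hmI, h]
    show χ q0 • B q0 = 0
    rw [this]
    exact smul_zero (A := Cn n →L[ℝ] Cn n) (χ q0 : ℝ)
  obtain ⟨r, hr, η, hη, H⟩ := core hA q0 hA0 (ρ := δ/4) (by linarith)
  let M : ℝ := ‖(P : Cn n →L[ℝ] Cn n)‖ + 1
  have hM : 0 < M := by positivity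
  refine ⟨r / M, by positivity, P ⁻¹' ball q0 η, P.continuous.continuousAt.preimage_mem_nhds (ball_mem_nhds _ hη), ?_⟩
  intro p hp v hv
  obtain ⟨f, hf0, hf1, hf⟩ := H (P p) hp (M⁻¹ • P v) (by
    rw [norm_smul, norm_inv, Real.norm_of_nonneg hM.le, inv_mul_le_iff₀ hM, mul_one]
    have := (P : Cn n →L[ℝ] Cn n).le_opNorm v
    rw [hv, mul_one] at this
    exact this.trans (by simp [M]))
  have hd : ∀ z ∈ ball (0:ℂ) 1, fderiv ℝ (fun z => P.symm (f z)) z = (P.symm : Cn n →L[ℝ] Cn n).comp (fderiv ℝ f z) :=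
    fun z hz => ((P.symm : Cn n →L[ℝ] Cn n).hasFDerivAt.comp z (hf z hz).2.1.hasFDerivAt).fderiv
  have hmem : ∀ z ∈ ball (0:ℂ) 1, P.symm (f z) ∈ Ω := fun z hz =>
    hball (ball_subset_ball (by linarith) (hf z hz).1)
  refine ⟨fun z => P.symm (f z), ⟨hmem, fun z hz => ⟨?_, ?_⟩⟩, by simp [hf0], ?_⟩
  · exact ((P.symm : Cn n →L[ℝ] Cn n).hasFDerivAt.comp z (hf z hz).2.1.hasFDerivAt).differentiableAt
  · obtain ⟨h1, h2, h3⟩ := hf z hz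
    set D := fderiv ℝ f z with hD
    have hχ : χ (f z) = 1 := χ.one_of_mem_closedBall (ball_subset_closedBall h1)
    have key : P.symm (D Complex.I) = J (P.symm (f z)) (P.symm (D 1)) := by
      rw [h3]
      simp [A, B, hχ, hmI]
    have key2 : J (P.symm (f z)) (P.symm (D Complex.I)) = - P.symm (D 1) := by
      rw [key, hJJ' _ (hmem z hz)]
    intro ξ
    rw [hd z hz]
    have e1 : Complex.I * ξ = ξ.re • Complex.I + (-ξ.im) • (1:ℂ) := by
      apply Complex.ext <;> simp
    have e2 : ξ = ξ.re • (1:ℂ) + ξ.im • Complex.I := by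
      apply Complex.ext <;> simp
    have l1 : D (Complex.I * ξ) = ξ.re • D Complex.I + (-ξ.im) • D 1 := by
      rw [e1, map_add, map_smul, map_smul]
    have l2 : D ξ = ξ.re • D 1 + ξ.im • D Complex.I := by
      conv_lhs => rw [e2, map_add, map_smul, map_smul]
    show P.symm (D (Complex.I * ξ)) = J (P.symm (f z)) (P.symm (D ξ))
    rw [l1, l2]
    simp only [map_add, map_smul, key2]
    rw [key]
    simp
  · rw [hd 0 (by simp)]
    show P.symm (fderiv ℝ f 0 1) = _
    rw [hf1, map_smul, map_smul, P.symm_apply_apply, smul_smul, div_eq_mul_inv]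

theorem main (n : ℕ) (Ω : Set (Cn n)) (hΩ : IsOpen Ω)
    (J : Cn n → (Cn n →L[ℝ] Cn n)) (hJ : IsAlmostComplexOn n Ω J)
    (K : Set (Cn n)) (hK : IsCompact K) (hKΩ : K ⊆ Ω) :
    sSup {c : ℝ≥0∞ | ∃ p ∈ K, ∃ v : Cn n, ‖v‖ = 1 ∧ c = kobayashiRoyden n Ω J p v} < ⊤ := by
  have : ∃ M : ℝ≥0∞, M < ⊤ ∧ ∀ p ∈ K, ∀ v : Cn n, ‖v‖ = 1 → kobayashiRoyden n Ω J p v ≤ M := by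
    refine hK.induction_on (p := fun S => ∃ M : ℝ≥0∞, M < ⊤ ∧ ∀ p ∈ S, ∀ v : Cn n, ‖v‖ = 1 → kobayashiRoyden n Ω J p v ≤ M) ?_ ?_ ?_ ?_
    · exact ⟨0, by simp, by simp⟩
    · rintro s t hst ⟨M, hM, h⟩
      exact ⟨M, hM, fun p hp => h p (hst hp)⟩
    · rintro s t ⟨M, hM, h⟩ ⟨M', hM', h'⟩
      refine ⟨max M M', max_lt hM hM', ?_⟩
      rintro p (hp | hp) v hv
      · exact (h p hp v hv).trans (le_max_left _ _)
      · exact (h' p hp v hv).trans (le_max_right _ _)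
    · intro p0 hp0
      obtain ⟨r, hr, U, hU, H⟩ := local_discs n Ω hΩ J hJ p0 (hKΩ hp0)
      refine ⟨U, mem_nhdsWithin_of_mem_nhds hU, ENNReal.ofReal (1 / r), ENNReal.ofReal_lt_top, ?_⟩
      intro p hp v hv
      exact sInf_le ⟨r, hr, H p hp v hv, rfl⟩
  obtain ⟨M, hM, h⟩ := this
  refine lt_of_le_of_lt (sSup_le ?_) hM
  rintro c ⟨p, hp, v, hv, rfl⟩
  exact h p hp v hv

end KR

/-- the Kobayashi–Royden pseudonorm restricted to unit tangent vectors is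
bounded over every compact subset of `Ω`. -/
theorem kobayashiRoyden_bounded_on_compact
    (n : ℕ) (hn : 1 ≤ n) (Ω : Set (Cn n)) (hΩ : IsOpen Ω) (hne : Ω.Nonempty)
    (J : Cn n → (Cn n →L[ℝ] Cn n)) (hJ : IsAlmostComplexOn n Ω J)
    (K : Set (Cn n)) (hK : IsCompact K) (hKΩ : K ⊆ Ω) :
    sSup {c : ℝ≥0∞ | ∃ p ∈ K, ∃ v : Cn n, ‖v‖ = 1 ∧ c = kobayashiRoyden n Ω J p v} < ⊤ := by
  exact KR.main n Ω hΩ J hJ K hK hKΩ
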